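/- There is a universal constant c > 0 such that for every dimension n ≥ 2, the supremum δ_n of densities of lattice sphere packings in R^n satisfies δ_n ≥ c n^2 · 2^{-n}. -/

import Mathlib

/- STATEMENT 0: There is a universal constant c > 0 such that for every dimension n ≥ 2,
the supremum δ_n of densities of lattice sphere packings in R^n satisfies
δ_n ≥ c n^2 · 2^{-n}. -/

open MeasureTheory
noncomputable section

abbrev Euc (n : ℕ) := EuclideanSpace ℝ (Fin n)

/-- The integer lattice points `ℤ^n ⊂ ℝ^n`. -/
def intPoints (n : ℕ) : Set (Euc n) := {x | ∀ i, ∃ m : ℤ, x i = (m : ℝ)}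

/-- The set of densities of lattice sphere packings in `ℝ^n`: a lattice `T(ℤ^n)` together
with a radius `r > 0` such that the open balls of radius `r` centered at the lattice points
are pairwise disjoint; the density is `Vol(r·B^n) / covolume`. -/
def packingDensities (n : ℕ) : Set ℝ :=
  {d : ℝ | ∃ (T : Euc n ≃ₗ[ℝ] Euc n) (r : ℝ), 0 < r ∧
    ((T '' intPoints n).Pairwise fun x y => Disjoint (Metric.ball x r) (Metric.ball y r)) ∧
    d = (volume (Metric.ball (0 : Euc n) r)).toReal /
      |LinearMap.det (T : Euc n →ₗ[ℝ] Euc n)|}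

section LatticePacking

open Set Filter Topology ProbabilityTheory
open scoped Matrix Pointwise

/-- The standard Gaussian density. -/
def gaussDensity (z : ℝ) : ℝ := gaussianPDFReal 0 1 z

/-- The standard Gaussian distribution function. -/
def gaussCDF (y : ℝ) : ℝ := ∫ z in Iic y, gaussDensity z

lemma gaussDensity_eq (z : ℝ) :
    gaussDensity z = (√(2 * Real.pi))⁻¹ * Real.exp (-(1 / 2) * z ^ 2) := by
  simp only [gaussDensity, gaussianPDFReal, NNReal.coe_one, mul_one, sub_zero]
  congr 2
  ring

lemma gaussDensity_nonneg (z : ℝ) : 0 ≤ gaussDensity z := gaussianPDFReal_nonneg _ _ _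

lemma integrable_gaussDensity : Integrable gaussDensity := integrable_gaussianPDFReal 0 1

lemma hasDerivAt_gaussDensity (z : ℝ) : HasDerivAt gaussDensity (-z * gaussDensity z) z := by
  have h : HasDerivAt (fun z : ℝ => (√(2 * Real.pi))⁻¹ * Real.exp (-(1 / 2) * z ^ 2))
      ((√(2 * Real.pi))⁻¹ * (Real.exp (-(1 / 2) * z ^ 2) * (-(1 / 2) * (2 * z)))) z := by
    have := (((hasDerivAt_pow 2 z).const_mul (-(1 / 2) : ℝ)).exp).const_mul (√(2 * Real.pi))⁻¹
    simpa using this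
  rw [gaussDensity_eq, show gaussDensity = _ from funext gaussDensity_eq]
  convert h using 1
  ring

lemma continuous_gaussDensity : Continuous gaussDensity :=
  continuous_iff_continuousAt.2 fun z => (hasDerivAt_gaussDensity z).continuousAt

lemma hasDerivAt_gaussCDF (y : ℝ) : HasDerivAt gaussCDF (gaussDensity y) y := by
  have h : gaussCDF = fun y => (∫ z in (0 : ℝ)..y, gaussDensity z) + gaussCDF 0 := by
    ext y
    have := intervalIntegral.integral_Iic_sub_Iic (μ := volume) (f := gaussDensity)
      (a := 0) (b := y) integrable_gaussDensity.integrableOn integrable_gaussDensity.integrableOn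
    simp only [gaussCDF]
    linarith
  rw [h]
  exact (intervalIntegral.integral_hasDerivAt_right
    (integrable_gaussDensity.intervalIntegrable)
    (continuous_gaussDensity.stronglyMeasurableAtFilter _ _)
    continuous_gaussDensity.continuousAt).add_const _

lemma gaussCDF_nonneg (y : ℝ) : 0 ≤ gaussCDF y :=
  setIntegral_nonneg measurableSet_Iic fun z _ => gaussDensity_nonneg z

lemma gaussCDF_mono : Monotone gaussCDF :=
  monotone_of_hasDerivAt_nonneg hasDerivAt_gaussCDF gaussDensity_nonneg

lemma gaussCDF_zero : gaussCDF 0 = 1 / 2 := by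
  have h1 : ∫ z in Ioi (0 : ℝ), gaussDensity z = gaussCDF 0 := by
    rw [gaussCDF, ← neg_zero, ← integral_comp_neg_Iic, neg_zero]
    congr 1
    ext z
    simp [gaussDensity_eq]
  have h2 := intervalIntegral.integral_Iic_add_Ioi (μ := volume) (f := gaussDensity) (b := 0)
    integrable_gaussDensity.integrableOn integrable_gaussDensity.integrableOn
  have h3 : ∫ z, gaussDensity z = 1 := integral_gaussianPDFReal_eq_one 0 one_ne_zero
  rw [h1, h3] at h2
  have h4 : ∫ z in Iic (0 : ℝ), gaussDensity z = gaussCDF 0 := rfl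
  linarith

lemma tendsto_gaussCDF_atBot : Tendsto gaussCDF atBot (𝓝 0) := by
  have h : gaussCDF = fun y => cdf (gaussianReal 0 1) y := by
    ext y
    rw [cdf_eq_real, measureReal_def, gaussianReal_apply_eq_integral _ one_ne_zero,
      ENNReal.toReal_ofReal (setIntegral_nonneg measurableSet_Iic fun z _ =>
        gaussianPDFReal_nonneg _ _ _)]
    rfl
  rw [h]
  exact tendsto_cdf_atBot _

lemma tendsto_mul_gaussDensity_atBot : Tendsto (fun z => z * gaussDensity z) atBot (𝓝 0) := by
  have h := ((tendsto_rpow_abs_mul_exp_neg_mul_sq_cocompact (a := 1 / 2) (by norm_num) 1).mono_left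
    atBot_le_cocompact).const_mul (√(2 * Real.pi))⁻¹
  rw [mul_zero] at h
  refine squeeze_zero_norm' (Eventually.of_forall fun z => ?_) h
  rw [gaussDensity_eq, Real.norm_eq_abs, abs_mul,
    abs_of_nonneg (a := _ * Real.exp _) (by positivity),
    Real.rpow_one]
  apply le_of_eq
  ring

lemma tendsto_gaussDensity_atBot : Tendsto gaussDensity atBot (𝓝 0) := by
  have h := ((tendsto_rpow_abs_mul_exp_neg_mul_sq_cocompact (a := 1 / 2) (by norm_num) 0).mono_left
    atBot_le_cocompact).const_mul (√(2 * Real.pi))⁻¹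
  rw [mul_zero] at h
  refine h.congr fun z => ?_
  rw [gaussDensity_eq, Real.rpow_zero, one_mul]

lemma integrable_mul_gaussDensity : Integrable fun z => z * gaussDensity z := by
  refine ((integrable_mul_exp_neg_mul_sq (b := 1 / 2) (by norm_num)).const_mul
    (√(2 * Real.pi))⁻¹).congr (Eventually.of_forall fun z => ?_)
  simp only [gaussDensity_eq]
  ring

lemma integrable_sq_mul_gaussDensity : Integrable fun z => z ^ 2 * gaussDensity z := by
  refine ((integrable_rpow_mul_exp_neg_mul_sq (b := 1 / 2) (by norm_num) (s := 2)
    (by norm_num)).const_mul (√(2 * Real.pi))⁻¹).congr (Eventually.of_forall fun z => ?_)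
  simp only [gaussDensity_eq, Real.rpow_two]
  ring

/-- The mean of `(y - Z)₊` for a standard Gaussian `Z`. -/
def gaussRamp (y : ℝ) : ℝ := y * gaussCDF y + gaussDensity y

/-- The mean of `(y - Z)₊²` for a standard Gaussian `Z`. -/
def gaussSqRamp (y : ℝ) : ℝ := (1 + y ^ 2) * gaussCDF y + y * gaussDensity y

lemma hasDerivAt_gaussRamp (y : ℝ) : HasDerivAt gaussRamp (gaussCDF y) y := by
  have := ((hasDerivAt_id y).mul (hasDerivAt_gaussCDF y)).add (hasDerivAt_gaussDensity y)
  refine this.congr_deriv ?_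
  simp

lemma hasDerivAt_gaussSqRamp (y : ℝ) : HasDerivAt gaussSqRamp (2 * gaussRamp y) y := by
  have := (((hasDerivAt_pow 2 y).const_add 1).mul (hasDerivAt_gaussCDF y)).add
    ((hasDerivAt_id y).mul (hasDerivAt_gaussDensity y))
  refine this.congr_deriv ?_
  simp [gaussRamp]
  ring

lemma gaussRamp_eq_integral (y : ℝ) :
    gaussRamp y = ∫ z in Iic y, (y - z) * gaussDensity z := by
  have h := integral_Iic_of_hasDerivAt_of_tendsto' (a := y) (m := 0)
    (f := fun z => y * gaussCDF z + gaussDensity z) (f' := fun z => (y - z) * gaussDensity z)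
    (fun z _ => (((hasDerivAt_gaussCDF z).const_mul y).add (hasDerivAt_gaussDensity z)).congr_deriv
      (by ring))
    (((integrable_gaussDensity.const_mul y).sub integrable_mul_gaussDensity).congr
      (Eventually.of_forall fun z => by simp; ring)).integrableOn
    (by simpa using (tendsto_gaussCDF_atBot.const_mul y).add tendsto_gaussDensity_atBot)
  rw [h, gaussRamp, sub_zero]

lemma integrable_sub_sq_mul_gaussDensity (y : ℝ) :
    Integrable fun z => (y - z) ^ 2 * gaussDensity z :=
  ((((integrable_gaussDensity.const_mul (y ^ 2)).sub
    (integrable_mul_gaussDensity.const_mul (2 * y)))).add integrable_sq_mul_gaussDensity).congr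
      (Eventually.of_forall fun z => by simp; ring)

lemma gaussSqRamp_eq_integral (y : ℝ) :
    gaussSqRamp y = ∫ z in Iic y, (y - z) ^ 2 * gaussDensity z := by
  have h := integral_Iic_of_hasDerivAt_of_tendsto' (a := y) (m := 0)
    (f := fun z => (1 + y ^ 2) * gaussCDF z + (2 * y * gaussDensity z - z * gaussDensity z))
    (f' := fun z => (y - z) ^ 2 * gaussDensity z)
    (fun z _ => (((hasDerivAt_gaussCDF z).const_mul (1 + y ^ 2)).add
      (((hasDerivAt_gaussDensity z).const_mul (2 * y)).sub
        ((hasDerivAt_id z).mul (hasDerivAt_gaussDensity z)))).congr_deriv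
      (by simp; ring))
    (integrable_sub_sq_mul_gaussDensity y).integrableOn
    (by simpa using (tendsto_gaussCDF_atBot.const_mul (1 + y ^ 2)).add
          ((tendsto_gaussDensity_atBot.const_mul (2 * y)).sub tendsto_mul_gaussDensity_atBot))
  rw [h, gaussSqRamp, sub_zero]
  ring

lemma gaussRamp_nonneg (y : ℝ) : 0 ≤ gaussRamp y := by
  rw [gaussRamp_eq_integral]
  exact setIntegral_nonneg measurableSet_Iic fun z hz =>
    mul_nonneg (sub_nonneg.2 hz) (gaussDensity_nonneg z)

lemma gaussSqRamp_nonneg (y : ℝ) : 0 ≤ gaussSqRamp y := by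
  rw [gaussSqRamp_eq_integral]
  exact setIntegral_nonneg measurableSet_Iic fun z _ =>
    mul_nonneg (sq_nonneg _) (gaussDensity_nonneg z)

lemma gaussSqRamp_mono : Monotone gaussSqRamp :=
  monotone_of_hasDerivAt_nonneg hasDerivAt_gaussSqRamp fun y =>
    mul_nonneg zero_le_two (gaussRamp_nonneg y)

lemma ofReal_gaussSqRamp (y : ℝ) :
    ENNReal.ofReal (gaussSqRamp y) =
      ∫⁻ z, ENNReal.ofReal ((max (y - z) 0) ^ 2) ∂(gaussianReal 0 1) := by
  rw [gaussianReal_of_var_ne_zero _ one_ne_zero,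
    lintegral_withDensity_eq_lintegral_mul _ (measurable_gaussianPDF 0 1) (by fun_prop),
    gaussSqRamp_eq_integral, ofReal_integral_eq_lintegral_ofReal
      (integrable_sub_sq_mul_gaussDensity y).integrableOn
      (Eventually.of_forall fun z => mul_nonneg (sq_nonneg _) (gaussDensity_nonneg z)),
    ← lintegral_indicator measurableSet_Iic]
  congr 1
  ext z
  simp only [Pi.mul_apply]
  by_cases hz : z ≤ y
  · rw [indicator_of_mem (show z ∈ Iic y from hz), max_eq_left (sub_nonneg.2 hz), mul_comm,
      ENNReal.ofReal_mul (gaussDensity_nonneg z)]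
    rfl
  · rw [indicator_of_notMem (show z ∉ Iic y from hz), max_eq_right (by linarith)]
    simp

lemma lintegral_exp_mul_gaussian (b : ℝ) :
    ∫⁻ z, ENNReal.ofReal (Real.exp (b * z)) ∂(gaussianReal 0 1) =
      ENNReal.ofReal (Real.exp (b ^ 2 / 2)) := by
  rw [← ofReal_integral_eq_lintegral_ofReal (integrable_exp_mul_gaussianReal b)
    (Eventually.of_forall fun z => (Real.exp_pos _).le)]
  congr 1
  have := congrFun (mgf_id_gaussianReal (μ := 0) (v := 1)) b
  simpa [mgf] using this

lemma gaussSqRamp_le_exp {m : ℝ} (hm : 0 < m) (y : ℝ) :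
    gaussSqRamp y ≤ 2 / m ^ 2 * Real.exp (m * y) * Real.exp (m ^ 2 / 2) := by
  rw [← ENNReal.ofReal_le_ofReal_iff (by positivity), ofReal_gaussSqRamp]
  calc ∫⁻ z, ENNReal.ofReal ((max (y - z) 0) ^ 2) ∂(gaussianReal 0 1)
      ≤ ∫⁻ z, ENNReal.ofReal (2 / m ^ 2 * Real.exp (m * y)) *
          ENNReal.ofReal (Real.exp (-m * z)) ∂(gaussianReal 0 1) := by
        refine lintegral_mono fun z => ?_
        rw [← ENNReal.ofReal_mul (by positivity)]
        apply ENNReal.ofReal_le_ofReal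
        rw [mul_assoc, ← Real.exp_add, show m * y + -m * z = m * (y - z) by ring]
        rcases le_total (y - z) 0 with h | h
        · rw [max_eq_right h, zero_pow two_ne_zero]
          positivity
        · rw [max_eq_left h, div_mul_eq_mul_div, le_div_iff₀ (by positivity)]
          have := Real.quadratic_le_exp_of_nonneg (mul_nonneg hm.le h)
          nlinarith [mul_nonneg hm.le h]
    _ = _ := by
        rw [lintegral_const_mul _ (by fun_prop), lintegral_exp_mul_gaussian,
          ← ENNReal.ofReal_mul (by positivity), neg_sq]

/-- Half the second moment of the positive part of `√s Z + s / 2 - v` for a standard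
Gaussian `Z`. It solves `∂ₛ f = (∂ᵥ² f - ∂ᵥ f) / 2`. -/
def heatPot (s v : ℝ) : ℝ := s / 2 * gaussSqRamp (√s / 2 - v / √s)

/-- The derivative of `heatPot` in its first argument. -/
def heatRate (s v : ℝ) : ℝ :=
  (gaussCDF (√s / 2 - v / √s) + √s * gaussRamp (√s / 2 - v / √s)) / 2

lemma heatPot_nonneg {s : ℝ} (hs : 0 ≤ s) (v : ℝ) : 0 ≤ heatPot s v :=
  mul_nonneg (by positivity) (gaussSqRamp_nonneg _)

lemma heatRate_nonneg (s v : ℝ) : 0 ≤ heatRate s v := by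
  have := gaussCDF_nonneg (√s / 2 - v / √s)
  have := mul_nonneg (Real.sqrt_nonneg s) (gaussRamp_nonneg (√s / 2 - v / √s))
  rw [heatRate]
  linarith

lemma quarter_le_heatRate_zero (s : ℝ) : 1 / 4 ≤ heatRate s 0 := by
  have h1 : gaussCDF 0 ≤ gaussCDF (√s / 2 - 0 / √s) := gaussCDF_mono (by simp; positivity)
  have := mul_nonneg (Real.sqrt_nonneg s) (gaussRamp_nonneg (√s / 2 - 0 / √s))
  rw [gaussCDF_zero] at h1
  rw [heatRate]
  linarith

lemma heatPot_antitone {s : ℝ} (hs : 0 ≤ s) : Antitone (heatPot s) := fun v w h => by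
  refine mul_le_mul_of_nonneg_left (gaussSqRamp_mono ?_) (by positivity)
  gcongr

lemma hasDerivAt_heatPot_left {s : ℝ} (hs : 0 < s) (v : ℝ) :
    HasDerivAt (fun s => heatPot s v) (heatRate s v) s := by
  have hr : 0 < √s := Real.sqrt_pos.2 hs
  have hsq : √s * √s = s := Real.mul_self_sqrt hs.le
  have h1 : HasDerivAt (fun s => √s / 2 - v / √s)
      (1 / (2 * √s) / 2 - (0 * √s - v * (1 / (2 * √s))) / √s ^ 2) s :=
    ((Real.hasDerivAt_sqrt hs.ne').div_const 2).sub
      ((hasDerivAt_const s v).div (Real.hasDerivAt_sqrt hs.ne') hr.ne')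
  have h2 := ((hasDerivAt_id s).div_const 2).mul
    ((hasDerivAt_gaussSqRamp (√s / 2 - v / √s)).comp s h1)
  refine h2.congr_deriv ?_
  simp only [heatRate, gaussSqRamp, gaussRamp, Function.comp, id]
  set P := gaussCDF (√s / 2 - v / √s)
  set p := gaussDensity (√s / 2 - v / √s)
  generalize √s = r at *
  subst hsq
  field_simp
  ring

lemma hasDerivAt_heatPot_log {s u : ℝ} (hs : 0 < s) (hu : 0 < u) :
    HasDerivAt (fun u => heatPot s (Real.log u))
      (-(√s * gaussRamp (√s / 2 - Real.log u / √s)) / u) u := by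
  have hr : 0 < √s := Real.sqrt_pos.2 hs
  have hsq : √s * √s = s := Real.mul_self_sqrt hs.le
  have h1 : HasDerivAt (fun u => √s / 2 - Real.log u / √s) (-(u⁻¹ / √s)) u :=
    ((Real.hasDerivAt_log hu.ne').div_const _).const_sub _
  have h2 := ((hasDerivAt_gaussSqRamp (√s / 2 - Real.log u / √s)).comp u h1).const_mul (s / 2)
  refine h2.congr_deriv ?_
  generalize √s = r at *
  subst hsq
  field_simp

lemma hasDerivAt_deriv_heatPot_log {s u : ℝ} (hs : 0 < s) (hu : 0 < u) :
    HasDerivAt (fun u => -(√s * gaussRamp (√s / 2 - Real.log u / √s)) / u)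
      (2 * heatRate s (Real.log u) / u ^ 2) u := by
  have hr : 0 < √s := Real.sqrt_pos.2 hs
  have h1 : HasDerivAt (fun u => √s / 2 - Real.log u / √s) (-(u⁻¹ / √s)) u :=
    ((Real.hasDerivAt_log hu.ne').div_const _).const_sub _
  have h2 := (((hasDerivAt_gaussRamp (√s / 2 - Real.log u / √s)).comp u h1).const_mul
    (√s)).neg.div (hasDerivAt_id u) hu.ne'
  refine h2.congr_deriv ?_
  simp only [heatRate, id, Function.comp, Pi.neg_apply]
  generalize gaussCDF _ = P
  generalize gaussRamp _ = p
  field_simp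
  ring

lemma continuous_gaussSqRamp : Continuous gaussSqRamp :=
  continuous_iff_continuousAt.2 fun y => (hasDerivAt_gaussSqRamp y).continuousAt

lemma continuousOn_heatPot_log :
    ContinuousOn (fun p : ℝ × ℝ => heatPot p.1 (Real.log p.2)) (Ioi 0 ×ˢ Ioi 0) := by
  unfold heatPot
  refine (by fun_prop : ContinuousOn (fun p : ℝ × ℝ => p.1 / 2) _).mul
    (continuous_gaussSqRamp.comp_continuousOn ?_)
  refine ContinuousOn.sub (by fun_prop) (ContinuousOn.div ?_ (by fun_prop) ?_)
  · exact continuousOn_snd.log fun p hp => ne_of_gt hp.2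
  · exact fun p hp => (Real.sqrt_pos.2 hp.1).ne'

lemma heatPot_le_exp {s m : ℝ} (hs : 0 < s) (hm : 0 < m) (v : ℝ) :
    heatPot s v ≤ Real.exp (m * s / 2 + m ^ 2 * s / 2) / m ^ 2 * Real.exp (-m * v) := by
  have hr : 0 < √s := Real.sqrt_pos.2 hs
  have hsq : √s * √s = s := Real.mul_self_sqrt hs.le
  have h := mul_le_mul_of_nonneg_left
    (gaussSqRamp_le_exp (mul_pos hm hr) (√s / 2 - v / √s)) (by positivity : 0 ≤ s / 2)
  refine h.trans_eq ?_
  have e1 : m * √s * (√s / 2 - v / √s) = m * (√s * √s) / 2 + -m * v := by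
    field_simp
    ring
  have e2 : (m * √s) ^ 2 = m ^ 2 * s := by rw [mul_pow, sq (√s), hsq]
  rw [e1, e2, hsq, Real.exp_add, Real.exp_add]
  field_simp

lemma ofReal_heatPot {s : ℝ} (hs : 0 < s) (v : ℝ) :
    ENNReal.ofReal (heatPot s v) =
      ∫⁻ z, ENNReal.ofReal ((max (s / 2 - √s * z - v) 0) ^ 2 / 2) ∂(gaussianReal 0 1) := by
  have hr : 0 < √s := Real.sqrt_pos.2 hs
  have hsq : √s * √s = s := Real.mul_self_sqrt hs.le
  rw [heatPot, ENNReal.ofReal_mul (by positivity), ofReal_gaussSqRamp,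
    ← lintegral_const_mul _ (by fun_prop)]
  congr 1
  ext z
  rw [← ENNReal.ofReal_mul (by positivity)]
  congr 1
  have : s / 2 - √s * z - v = √s * (√s / 2 - v / √s - z) := by
    rw [mul_sub, mul_sub, mul_div_cancel₀ _ hr.ne', ← mul_div_assoc, hsq]; ring
  rw [this, ← mul_zero (√s), ← mul_max_of_nonneg _ _ hr.le, mul_pow, sq (√s), hsq, mul_zero]
  ring

/-- The universal constant `∑ (2k + 1) e^{-k}`. -/
def expSum : ℝ := ∑' k : ℕ, (2 * (k : ℝ) + 1) * Real.exp (-k)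

lemma summable_expSum : Summable fun k : ℕ => (2 * (k : ℝ) + 1) * Real.exp (-k) := by
  have h1 := Real.summable_pow_mul_exp_neg_nat_mul 1 one_pos
  have h0 := Real.summable_pow_mul_exp_neg_nat_mul 0 one_pos
  refine ((h1.mul_left 2).add h0).congr fun k => ?_
  simp
  ring

lemma expSum_nonneg : 0 ≤ expSum := tsum_nonneg fun k => by positivity

lemma sum_range_two_mul_add_one (m : ℕ) :
    ∑ k ∈ Finset.range m, (2 * (k : ℝ) + 1) = (m : ℝ) ^ 2 := by
  induction m with
  | zero => simp
  | succ m ih =>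
    rw [Finset.sum_range_succ, ih]
    push_cast
    ring

lemma sq_posPart_le_tsum_indicator {n : ℕ} (hn : 0 < n) (w : ℝ) (y : Euc n) :
    ENNReal.ofReal ((max (w - 2 * Real.log (max 1 ‖y‖)) 0) ^ 2 / 2) ≤
      ENNReal.ofReal (2 / n ^ 2) * ∑' k : ℕ, (Metric.ball (0 : Euc n)
        (Real.exp (w / 2 - k / n))).indicator (fun _ => ENNReal.ofReal (2 * k + 1)) y := by
  have hn' : (0 : ℝ) < n := Nat.cast_pos.2 hn
  set v := 2 * Real.log (max 1 ‖y‖) with hv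
  rcases le_or_gt (w - v) 0 with h | h
  · rw [max_eq_right h]
    simp
  rw [max_eq_left h.le]
  set t := n * (w - v) / 2 with ht
  have ht0 : 0 < t := by positivity
  calc ENNReal.ofReal ((w - v) ^ 2 / 2)
      ≤ ENNReal.ofReal (2 / n ^ 2 * ∑ k ∈ Finset.range ⌈t⌉₊, (2 * (k : ℝ) + 1)) := by
        apply ENNReal.ofReal_le_ofReal
        rw [sum_range_two_mul_add_one]
        have h1 : t ^ 2 ≤ (⌈t⌉₊ : ℝ) ^ 2 := pow_le_pow_left₀ ht0.le (Nat.le_ceil t) 2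
        have h2 : (w - v) ^ 2 / 2 = 2 / n ^ 2 * t ^ 2 := by
          rw [ht]
          field_simp
        rw [h2]
        gcongr
    _ = ENNReal.ofReal (2 / n ^ 2) * ∑ k ∈ Finset.range ⌈t⌉₊, ENNReal.ofReal (2 * (k : ℝ) + 1) := by
        rw [ENNReal.ofReal_mul (by positivity),
          ENNReal.ofReal_sum_of_nonneg fun k _ => by positivity]
    _ ≤ _ := by
        gcongr
        refine le_trans (Finset.sum_le_sum fun k hk => ?_) (ENNReal.sum_le_tsum (Finset.range ⌈t⌉₊))
        rw [indicator_of_mem]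
        have hk' : (k : ℝ) < t := Nat.lt_ceil.1 (Finset.mem_range.1 hk)
        have h3 : Real.log (max 1 ‖y‖) < w / 2 - k / n := by
          have : (k : ℝ) / n < t / n := by gcongr
          have h4 : t / n = (w - v) / 2 := by rw [ht]; field_simp
          rw [h4] at this
          linarith
        rw [Real.log_lt_iff_lt_exp (by positivity)] at h3
        rw [mem_ball_zero_iff]
        exact (le_max_right _ _).trans_lt h3

lemma lintegral_sq_posPart_le {n : ℕ} (hn : 0 < n) (w : ℝ) :
    ∫⁻ y : Euc n, ENNReal.ofReal ((max (w - 2 * Real.log (max 1 ‖y‖)) 0) ^ 2 / 2) ≤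
      ENNReal.ofReal (2 / n ^ 2 * expSum) * volume (Metric.ball (0 : Euc n) 1) *
        ENNReal.ofReal (Real.exp (n * w / 2)) := by
  have hn' : (0 : ℝ) < n := Nat.cast_pos.2 hn
  refine (lintegral_mono fun y => sq_posPart_le_tsum_indicator hn w y).trans_eq ?_
  rw [lintegral_const_mul _ (Measurable.tsum fun k =>
      measurable_const.indicator Metric.isOpen_ball.measurableSet),
    lintegral_tsum fun k =>
      (measurable_const.indicator Metric.isOpen_ball.measurableSet).aemeasurable]
  have h1 : ∀ k : ℕ, ∫⁻ y : Euc n, (Metric.ball (0 : Euc n)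
        (Real.exp (w / 2 - k / n))).indicator (fun _ => ENNReal.ofReal (2 * k + 1)) y =
      ENNReal.ofReal ((2 * k + 1) * Real.exp (-k)) *
        (volume (Metric.ball (0 : Euc n) 1) * ENNReal.ofReal (Real.exp (n * w / 2))) := by
    intro k
    rw [lintegral_indicator_const Metric.isOpen_ball.measurableSet,
      Measure.addHaar_ball_of_pos _ _ (Real.exp_pos _), finrank_euclideanSpace_fin,
      ← Real.exp_nat_mul,
      show (n : ℝ) * (w / 2 - k / n) = -k + n * w / 2 by field_simp; ring, Real.exp_add,
      ENNReal.ofReal_mul (by positivity), ENNReal.ofReal_mul (by positivity)]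
    ring
  simp_rw [h1]
  rw [ENNReal.tsum_mul_right, ← ENNReal.ofReal_tsum_of_nonneg (fun k => by positivity)
    summable_expSum, ENNReal.ofReal_mul (by positivity)]
  change _ * (ENNReal.ofReal expSum * _) = _
  ring

lemma lintegral_heatPot_le {n : ℕ} (hn : 0 < n) {s : ℝ} (hs : 0 < s) :
    ∫⁻ y : Euc n, ENNReal.ofReal (heatPot s (2 * Real.log (max 1 ‖y‖))) ≤
      ENNReal.ofReal (2 / n ^ 2 * expSum * Real.exp (n ^ 2 * s / 8 + n * s / 4)) *
        volume (Metric.ball (0 : Euc n) 1) := by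
  have hsq : √s * √s = s := Real.mul_self_sqrt hs.le
  simp_rw [ofReal_heatPot hs]
  rw [lintegral_lintegral_swap (by fun_prop)]
  refine (lintegral_mono fun z => lintegral_sq_posPart_le hn (s / 2 - √s * z)).trans_eq ?_
  rw [lintegral_const_mul _ (by fun_prop)]
  have h1 : ∀ z, ENNReal.ofReal (Real.exp (n * (s / 2 - √s * z) / 2)) =
      ENNReal.ofReal (Real.exp (n * s / 4)) * ENNReal.ofReal (Real.exp (-(n * √s / 2) * z)) := by
    intro z
    rw [← ENNReal.ofReal_mul (by positivity), ← Real.exp_add]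
    congr 2
    ring
  simp_rw [h1]
  rw [lintegral_const_mul _ (by fun_prop), lintegral_exp_mul_gaussian,
    ← ENNReal.ofReal_mul (by positivity), ← Real.exp_add, mul_right_comm,
    ← ENNReal.ofReal_mul (mul_nonneg (by positivity) expSum_nonneg)]
  congr 4
  rw [neg_sq, div_pow, mul_pow, sq (√s), hsq]
  ring

/-- The point of Euclidean space with given integer coordinates. -/
def intVec {n : ℕ} (x : Fin n → ℤ) : Euc n := WithLp.toLp 2 fun i => (x i : ℝ)

@[simp] lemma intVec_apply {n : ℕ} (x : Fin n → ℤ) (i : Fin n) : intVec x i = x i := rfl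

lemma intVec_injective {n : ℕ} : Function.Injective (intVec (n := n)) := by
  intro x y h
  funext i
  have := congrArg (fun v : Euc n => v i) h
  simpa using this

lemma one_le_norm_intVec {n : ℕ} {x : Fin n → ℤ} (hx : x ≠ 0) : 1 ≤ ‖intVec x‖ := by
  obtain ⟨i, hi⟩ := Function.ne_iff.1 hx
  refine le_trans ?_ (PiLp.norm_apply_le (intVec x) i)
  rw [intVec_apply, Real.norm_eq_abs]
  exact_mod_cast Int.one_le_abs hi

lemma tsum_norm_intVec_ne_top (n : ℕ) :
    ∑' x : Fin n → ℤ, ENNReal.ofReal ((‖intVec x‖ ^ (n + 1))⁻¹) ≠ ⊤ := by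
  set b := (EuclideanSpace.basisFun (Fin n) ℝ).toBasis
  set L := Submodule.span ℤ (range b)
  have hrank : Module.finrank ℤ L = n := by
    rw [ZLattice.rank ℝ L]
    simp
  have hs := ZLattice.summable_norm_pow_inv L (n + 1) (by omega)
  have hmem : ∀ x : Fin n → ℤ, intVec x ∈ L := by
    intro x
    have : intVec x = ∑ i, x i • b i := by
      ext j
      simp [b, Finset.sum_apply, Pi.single_apply]
    rw [this]
    exact Submodule.sum_mem _ fun i _ =>
      Submodule.smul_mem _ _ (Submodule.subset_span (mem_range_self i))
  have hinj : Function.Injective fun x : Fin n → ℤ => (⟨intVec x, hmem x⟩ : L) := by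
    intro x y h
    exact intVec_injective (congrArg Subtype.val h)
  have hs' := hs.comp_injective hinj
  have : Summable fun x : Fin n → ℤ => (‖intVec x‖ ^ (n + 1))⁻¹ := by
    refine hs'.congr fun x => ?_
    simp
  exact this.tsum_ofReal_ne_top

lemma norm_sub_le_of_mem_cube {n : ℕ} {h : ℝ} (hh : 0 < h) (x : Fin n → ℤ) (y : Euc n)
    (hy : ∀ i, h * x i ≤ y i ∧ y i < h * (x i + 1)) : ‖y - h • intVec x‖ ≤ h * n := by
  rcases n.eq_zero_or_pos with rfl | hn
  · rw [Subsingleton.elim (y - h • intVec x) 0]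
    simp
  rw [EuclideanSpace.norm_eq]
  have hn' : (1 : ℝ) ≤ n := Nat.one_le_cast.2 hn
  apply Real.sqrt_le_iff.2 ⟨by positivity, ?_⟩
  calc ∑ i, ‖(y - h • intVec x) i‖ ^ 2 ≤ ∑ _i : Fin n, h ^ 2 := by
        refine Finset.sum_le_sum fun i _ => ?_
        have := hy i
        rw [Real.norm_eq_abs, sq_abs]
        have h1 : (y - h • intVec x) i = y i - h * x i := by simp
        rw [h1]
        nlinarith
    _ = h ^ 2 * n := by simp [mul_comm]
    _ ≤ (h * n) ^ 2 := by
        rw [mul_pow]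
        gcongr
        nlinarith

/-- Comparison of a lattice sum of a radial decreasing function with its integral. -/
lemma lattice_sum_le_lintegral {n : ℕ} {φ : ℝ → ENNReal} (hφ : Antitone φ)
    (hφ1 : ∀ r, 0 ≤ r → r < 1 → φ r = φ 0) {h η : ℝ} (hh : 0 < h) (hη : η < 1)
    (hhη : h * n ≤ η) :
    ENNReal.ofReal (h ^ n) * ∑' x : Fin n → ℤ, φ (h * ‖intVec x‖) ≤
      ENNReal.ofReal (((1 - η) ^ n)⁻¹) * ∫⁻ y : Euc n, φ ‖y‖ := by
  have hη0 : 0 ≤ η := le_trans (by positivity) hhη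
  set Q : (Fin n → ℤ) → Set (Euc n) := fun x =>
    WithLp.ofLp ⁻¹' (univ.pi fun i => Ico (h * (x i : ℝ)) (h * (x i + 1))) with hQ
  have hmem : ∀ x y, y ∈ Q x ↔ ∀ i, h * x i ≤ y i ∧ y i < h * (x i + 1) := by
    intro x y
    simp [hQ]
  have hQm : ∀ x, MeasurableSet (Q x) := fun x =>
    (PiLp.volume_preserving_ofLp (Fin n)).measurable
      (MeasurableSet.univ_pi fun i => measurableSet_Ico)
  have hQv : ∀ x, volume (Q x) = ENNReal.ofReal (h ^ n) := by
    intro x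
    rw [hQ, (PiLp.volume_preserving_ofLp (Fin n)).measure_preimage
      (MeasurableSet.univ_pi fun i => measurableSet_Ico).nullMeasurableSet, Real.volume_pi_Ico]
    simp only [mul_add, mul_one, add_sub_cancel_left, Finset.prod_const, Finset.card_univ,
      Fintype.card_fin]
    rw [ENNReal.ofReal_pow hh.le]
  have hdisj : Pairwise (Function.onFun Disjoint Q) := by
    intro x y hxy
    rw [Function.onFun, Set.disjoint_left]
    intro z hzx hzy
    apply hxy
    funext i
    have h1 := (hmem x z).1 hzx i
    have h2 := (hmem y z).1 hzy i
    have h3 : (x i : ℝ) < y i + 1 := lt_of_mul_lt_mul_left (h1.1.trans_lt h2.2) hh.le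
    have h4 : (y i : ℝ) < x i + 1 := lt_of_mul_lt_mul_left (h2.1.trans_lt h1.2) hh.le
    have h5 : x i < y i + 1 := by exact_mod_cast h3
    have h6 : y i < x i + 1 := by exact_mod_cast h4
    omega
  have hφm : Measurable φ := hφ.measurable
  have hcomp : ∀ x, ∀ y ∈ Q x, φ (h * ‖intVec x‖) ≤ φ (‖(1 - η) • y‖) := by
    intro x y hy
    have h1 := norm_sub_le_of_mem_cube hh x y ((hmem x y).1 hy)
    have h2 : ‖h • intVec x‖ = h * ‖intVec x‖ := by
      rw [norm_smul, Real.norm_of_nonneg hh.le]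
    have h3 : ‖(1 - η) • y‖ = (1 - η) * ‖y‖ := by
      rw [norm_smul, Real.norm_of_nonneg (by linarith)]
    rw [h3]
    rcases lt_or_ge ‖y‖ 1 with hy1 | hy1
    · rw [hφ1 ((1 - η) * ‖y‖) (mul_nonneg (by linarith) (norm_nonneg y)) (by
        nlinarith [norm_nonneg y])]
      exact hφ (by positivity)
    · apply hφ
      have h4 : ‖y‖ ≤ ‖y - h • intVec x‖ + ‖h • intVec x‖ := by
        simpa using norm_add_le (y - h • intVec x) (h • intVec x)
      nlinarith
  calc ENNReal.ofReal (h ^ n) * ∑' x : Fin n → ℤ, φ (h * ‖intVec x‖)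
      = ∑' x : Fin n → ℤ, ∫⁻ _y in Q x, φ (h * ‖intVec x‖) := by
        rw [← ENNReal.tsum_mul_left]
        refine tsum_congr fun x => ?_
        rw [setLIntegral_const, hQv, mul_comm]
    _ ≤ ∑' x : Fin n → ℤ, ∫⁻ y in Q x, φ (‖(1 - η) • y‖) := by
        refine ENNReal.tsum_le_tsum fun x => ?_
        exact setLIntegral_mono' (hQm x) (hcomp x)
    _ = ∫⁻ y in ⋃ x, Q x, φ (‖(1 - η) • y‖) := (lintegral_iUnion hQm hdisj _).symm
    _ ≤ ∫⁻ y : Euc n, φ (‖(1 - η) • y‖) := setLIntegral_le_lintegral _ _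
    _ = ∫⁻ y : Euc n, φ ‖y‖ ∂(Measure.map (fun y : Euc n => (1 - η) • y) volume) := by
        exact (lintegral_map (hφm.comp measurable_norm)
          (measurable_const_smul (α := Euc n) (1 - η))).symm
    _ = _ := by
        rw [Measure.map_addHaar_smul _ (by linarith), lintegral_smul_measure,
          finrank_euclideanSpace_fin,
          abs_of_nonneg (inv_nonneg.2 (pow_nonneg (by linarith) n)), smul_eq_mul]

/-- The integer vector `(y₀, y₀ a + p y')`. -/
def skewVec {m : ℕ} (p : ℕ) (a : Fin m → Fin p) (y : Fin (m + 1) → ℤ) : Fin (m + 1) → ℤ :=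
  Fin.cons (y 0) fun j => y 0 * (a j : ℕ) + p * y j.succ

lemma skewVec_injective {m p : ℕ} (hp : 0 < p) (a : Fin m → Fin p) :
    Function.Injective (skewVec p a) := by
  intro y z h
  have h0 : y 0 = z 0 := by simpa [skewVec] using congrFun h 0
  funext i
  refine Fin.cases h0 (fun j => ?_) i
  have := congrFun h j.succ
  simp only [skewVec, Fin.cons_succ, h0, add_right_inj] at this
  exact mul_left_cancel₀ (by exact_mod_cast hp.ne') this

/-- A pair `(a, y)` with `p ∤ y₀` is determined by the associated integer vector. -/
lemma skewVec_injOn {m p : ℕ} (hp : p.Prime) {a b : Fin m → Fin p} {y z : Fin (m + 1) → ℤ}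
    (hy : ¬ (p : ℤ) ∣ y 0) (h : skewVec p a y = skewVec p b z) : a = b ∧ y = z := by
  have h0 : y 0 = z 0 := by simpa [skewVec] using congrFun h 0
  have hab : a = b := by
    funext j
    have hj := congrFun h j.succ
    simp only [skewVec, Fin.cons_succ] at hj
    have hdvd : (p : ℤ) ∣ y 0 * (((a j : ℕ) : ℤ) - ((b j : ℕ) : ℤ)) :=
      ⟨z j.succ - y j.succ, by rw [← h0] at hj; linarith⟩
    rcases (Nat.prime_iff_prime_int.1 hp).dvd_or_dvd hdvd with h1 | h1
    · exact absurd h1 hy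
    · have ha := (a j).2
      have hb := (b j).2
      have := Int.eq_zero_of_abs_lt_dvd h1 (by rw [abs_lt]; omega)
      exact Fin.ext (by omega)
  subst hab
  exact ⟨rfl, skewVec_injective hp.pos a h⟩

/-- If `p ∣ y₀`, the skew vector is `p` times an integer vector. -/
lemma exists_skewVec_eq_mul {m p : ℕ} (a : Fin m → Fin p) :
    ∃ F : (Fin (m + 1) → ℤ) → (Fin (m + 1) → ℤ), ∀ y, (p : ℤ) ∣ y 0 →
      skewVec p a y = fun i => p * F y i := by
  refine ⟨fun y i => skewVec p a y i / p, fun y hy => ?_⟩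
  funext i
  refine (Int.mul_ediv_cancel' ?_).symm
  refine Fin.cases ?_ (fun j => ?_) i
  · simpa [skewVec] using hy
  · simp only [skewVec, Fin.cons_succ]
    exact dvd_add (Dvd.dvd.mul_right hy _) (dvd_mul_right _ _)

/-- Sum over all shears of the lattice sums. -/
lemma sum_skewVec_le {m p : ℕ} (hp : p.Prime) (g : (Fin (m + 1) → ℤ) → ENNReal) :
    ∑ a : Fin m → Fin p, ∑' y : {y : Fin (m + 1) → ℤ // y ≠ 0}, g (skewVec p a y) ≤
      (p : ENNReal) ^ m * (∑' z : {z : Fin (m + 1) → ℤ // z ≠ 0}, g (fun i => p * z.1 i)) +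
        ∑' x : Fin (m + 1) → ℤ, g x := by
  set A : Set {y : Fin (m + 1) → ℤ // y ≠ 0} := {y | (p : ℤ) ∣ y.1 0}
  have hsplit : ∀ a : Fin m → Fin p,
      ∑' y : {y : Fin (m + 1) → ℤ // y ≠ 0}, g (skewVec p a y) =
        (∑' y : A, g (skewVec p a y)) + ∑' y : (Aᶜ : Set _), g (skewVec p a y) := by
    intro a
    exact (ENNReal.summable.tsum_add_tsum_compl ENNReal.summable).symm
  simp_rw [hsplit]
  rw [Finset.sum_add_distrib]
  gcongr
  · have hle : ∀ a : Fin m → Fin p, ∑' y : A, g (skewVec p a y) ≤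
        ∑' z : {z : Fin (m + 1) → ℤ // z ≠ 0}, g (fun i => p * z.1 i) := by
      intro a
      obtain ⟨F, hF⟩ := exists_skewVec_eq_mul a
      have hne : ∀ y : A, F y.1.1 ≠ 0 := by
        intro y h0
        have h1 := hF y.1.1 y.2
        rw [h0] at h1
        have h2 : skewVec p a y.1.1 = skewVec p a 0 := by
          rw [h1]
          funext i
          refine Fin.cases ?_ (fun j => ?_) i <;> simp [skewVec]
        exact y.1.2 (skewVec_injective hp.pos a h2)
      have hinj : Function.Injective
          fun y : A => (⟨F y.1.1, hne y⟩ : {z : Fin (m + 1) → ℤ // z ≠ 0}) := by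
        intro y z h
        have h1 : F y.1.1 = F z.1.1 := congrArg Subtype.val h
        have h2 : skewVec p a y.1.1 = skewVec p a z.1.1 := by
          rw [hF _ y.2, hF _ z.2, h1]
        exact Subtype.ext (Subtype.ext (skewVec_injective hp.pos a h2))
      refine le_trans (le_of_eq ?_) (ENNReal.tsum_comp_le_tsum_of_injective hinj
        fun z : {z : Fin (m + 1) → ℤ // z ≠ 0} => g (fun i => p * z.1 i))
      exact tsum_congr fun y => by rw [hF _ y.2]
    refine (Finset.sum_le_sum fun a _ => hle a).trans (le_of_eq ?_)
    rw [Finset.sum_const, Finset.card_univ, Fintype.card_fun, Fintype.card_fin, Fintype.card_fin,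
      nsmul_eq_mul]
    push_cast
    rfl
  · have hinj : Function.Injective
        fun q : (Fin m → Fin p) × (Aᶜ : Set {y : Fin (m + 1) → ℤ // y ≠ 0}) =>
          skewVec p q.1 q.2.1.1 := by
      rintro ⟨a, y⟩ ⟨b, z⟩ h
      obtain ⟨h1, h2⟩ := skewVec_injOn hp y.2 h
      exact Prod.ext h1 (Subtype.ext (Subtype.ext h2))
    refine le_trans (le_of_eq ?_) (ENNReal.tsum_comp_le_tsum_of_injective hinj g)
    rw [ENNReal.tsum_prod', tsum_fintype]

/-- The matrix of the linear map whose restriction to integer vectors is `skewVec`. -/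
def skewMatrix {m : ℕ} (p : ℕ) (a : Fin m → Fin p) : Matrix (Fin (m + 1)) (Fin (m + 1)) ℝ :=
  Matrix.of (Fin.cons (Pi.single 0 1) fun k =>
    Pi.single 0 ((a k : ℕ) : ℝ) + Pi.single k.succ (p : ℝ))

lemma skewMatrix_mulVec {m p : ℕ} (a : Fin m → Fin p) (y : Fin (m + 1) → ℤ) :
    (skewMatrix p a).mulVec (fun i => (y i : ℝ)) = fun i => (skewVec p a y i : ℝ) := by
  funext i
  refine Fin.cases ?_ (fun j => ?_) i
  · simp [skewMatrix, skewVec, Matrix.mulVec]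
  · change (Pi.single 0 ((a j : ℕ) : ℝ) + Pi.single j.succ (p : ℝ)) ⬝ᵥ (fun i => (y i : ℝ)) = _
    rw [add_dotProduct]
    simp [skewVec, mul_comm]

lemma det_skewMatrix {m p : ℕ} (a : Fin m → Fin p) : (skewMatrix p a).det = (p : ℝ) ^ m := by
  rw [Matrix.det_of_isLowerTriangular, Fin.prod_univ_succ]
  · simp [skewMatrix]
  · intro i j hij
    have hij' : i < j := by simpa using hij
    revert hij'
    refine Fin.cases (fun h => ?_) (fun k h => ?_) i
    · simp [skewMatrix, h.ne']
    · have h0 : j ≠ 0 := (lt_of_le_of_lt (Fin.zero_le _) h).ne'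
      simp [skewMatrix, h0, h.ne']

/-- The mean value theorem of Minkowski and Hlawka, for radial decreasing functions. -/
lemma exists_lattice_sum_lt_one {n : ℕ} (hn : 2 ≤ n) {φ : ℝ → ENNReal} (hφ : Antitone φ)
    (hφ1 : ∀ r, 0 ≤ r → r < 1 → φ r = φ 0) {C : ENNReal} (hC : C ≠ ⊤)
    (hdec : ∀ r, 1 ≤ r → φ r ≤ C * ENNReal.ofReal ((r ^ (n + 1))⁻¹)) {γ : ℝ} (hγ : 0 < γ)
    (hI : ∫⁻ y : Euc n, φ ‖y‖ < ENNReal.ofReal γ) :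
    ∃ S : Matrix (Fin n) (Fin n) ℝ, S.det = γ ∧
      ∑' x : {x : Fin n → ℤ // x ≠ 0},
        φ ‖WithLp.toLp 2 (S.mulVec fun i => (x.1 i : ℝ))‖ < 1 := by
  obtain ⟨m, rfl⟩ : ∃ m, n = m + 1 := ⟨n - 1, by omega⟩
  have hm : m ≠ 0 := by omega
  set I := ∫⁻ y : Euc (m + 1), φ ‖y‖ with hIdef
  set Z := ∑' x : Fin (m + 1) → ℤ, ENNReal.ofReal ((‖intVec x‖ ^ (m + 1 + 1))⁻¹) with hZdef
  have hZ : Z ≠ ⊤ := tsum_norm_intVec_ne_top (m + 1)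
  set R : ℕ → ℝ := fun p => (γ * p) ^ (((m + 1 : ℕ) : ℝ)⁻¹) with hR
  set h : ℕ → ℝ := fun p => R p / p with hh
  have hRn : ∀ p, R p ^ (m + 1) = γ * p := fun p =>
    Real.rpow_inv_natCast_pow (by positivity) (by omega)
  have hhn : ∀ p, p ≠ 0 → h p ^ (m + 1) = γ * ((p : ℝ) ^ m)⁻¹ := by
    intro p hp
    have : (p : ℝ) ≠ 0 := Nat.cast_ne_zero.2 hp
    rw [hh]
    simp only
    rw [div_pow, hRn]
    field_simp
    ring
  have hRtop : Tendsto R atTop atTop :=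
    (tendsto_rpow_atTop (by positivity)).comp
      (tendsto_natCast_atTop_atTop.const_mul_atTop hγ)
  have hh0 : Tendsto h atTop (𝓝 0) := by
    have h1 : Tendsto (fun p : ℕ => (γ * ((p : ℝ) ^ m)⁻¹) ^ (((m + 1 : ℕ) : ℝ)⁻¹)) atTop (𝓝 0) := by
      have h2 : Tendsto (fun p : ℕ => γ * ((p : ℝ) ^ m)⁻¹) atTop (𝓝 0) := by
        simpa using ((tendsto_inv_atTop_zero.comp
          ((tendsto_pow_atTop hm).comp tendsto_natCast_atTop_atTop)).const_mul γ)
      have h3 := h2.rpow_const (p := ((m + 1 : ℕ) : ℝ)⁻¹) (Or.inr (by positivity))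
      rwa [Real.zero_rpow (by positivity)] at h3
    refine h1.congr' ?_
    filter_upwards [eventually_ne_atTop 0] with p hp
    rw [← hhn p hp]
    refine Real.pow_rpow_inv_natCast ?_ (by omega)
    positivity
  have hlim1 : Tendsto (fun p => C * (ENNReal.ofReal ((R p ^ (m + 1 + 1))⁻¹) * Z)) atTop
      (𝓝 0) := by
    have h1 : Tendsto (fun p => (R p ^ (m + 1 + 1))⁻¹) atTop (𝓝 0) :=
      tendsto_inv_atTop_zero.comp ((tendsto_pow_atTop (by omega)).comp hRtop)
    have h2 := ENNReal.Tendsto.const_mul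
      (ENNReal.Tendsto.mul_const (ENNReal.tendsto_ofReal h1) (Or.inr hZ)) (Or.inr hC)
    simpa using h2
  have hlim2 : Tendsto (fun p => ENNReal.ofReal γ⁻¹ *
      (ENNReal.ofReal (((1 - h p * (m + 1 : ℕ)) ^ (m + 1))⁻¹) * I)) atTop
      (𝓝 (ENNReal.ofReal γ⁻¹ * I)) := by
    have h1 : Tendsto (fun p => ((1 - h p * (m + 1 : ℕ)) ^ (m + 1))⁻¹) atTop (𝓝 1) := by
      have h2 := (((hh0.mul_const ((m + 1 : ℕ) : ℝ)).const_sub 1).pow (m + 1)).inv₀ (by simp)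
      simpa using h2
    have h2 := ENNReal.Tendsto.const_mul (a := ENNReal.ofReal γ⁻¹)
      (ENNReal.Tendsto.mul_const (b := I) (ENNReal.tendsto_ofReal h1) (Or.inr hI.ne_top))
      (Or.inr ENNReal.ofReal_ne_top)
    simpa using h2
  have hlt : ENNReal.ofReal γ⁻¹ * I < 1 := by
    calc ENNReal.ofReal γ⁻¹ * I < ENNReal.ofReal γ⁻¹ * ENNReal.ofReal γ :=
          (ENNReal.mul_lt_mul_iff_right (by simpa using hγ) ENNReal.ofReal_ne_top).2 hI
      _ = 1 := by
          rw [← ENNReal.ofReal_mul (by positivity), inv_mul_cancel₀ hγ.ne', ENNReal.ofReal_one]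
  have hlim := hlim1.add hlim2
  rw [zero_add] at hlim
  have hev := (hlim.eventually_lt_const hlt).and ((hRtop.eventually_ge_atTop 1).and
    (((hh0.mul_const ((m + 1 : ℕ) : ℝ)).eventually_lt_const (u := 1) (by simp)).and
      (eventually_ne_atTop 0)))
  obtain ⟨N, hN⟩ := eventually_atTop.1 hev
  obtain ⟨p, hNp, hp⟩ := Nat.exists_infinite_primes N
  obtain ⟨hp1, hp2, hp3, hp0⟩ := hN p hNp
  have hp0' : (0 : ℝ) < p := Nat.cast_pos.2 hp.pos
  have hhp : 0 < h p := div_pos (by linarith) hp0'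
  have hsum := sum_skewVec_le (m := m) hp fun x => φ (h p * ‖intVec x‖)
  have htail : ∑' z : {z : Fin (m + 1) → ℤ // z ≠ 0},
      φ (h p * ‖intVec fun i => (p : ℤ) * z.1 i‖) ≤
        C * (ENNReal.ofReal ((R p ^ (m + 1 + 1))⁻¹) * Z) := by
    calc _ ≤ ∑' z : {z : Fin (m + 1) → ℤ // z ≠ 0}, C * (ENNReal.ofReal ((R p ^ (m + 1 + 1))⁻¹) *
          ENNReal.ofReal ((‖intVec z.1‖ ^ (m + 1 + 1))⁻¹)) := by
          refine ENNReal.tsum_le_tsum fun z => ?_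
          have h1 : h p * ‖intVec fun i => (p : ℤ) * z.1 i‖ = R p * ‖intVec z.1‖ := by
            have h2 : (intVec fun i => (p : ℤ) * z.1 i) = (p : ℝ) • intVec z.1 := by
              ext i
              simp
            rw [h2, norm_smul, Real.norm_of_nonneg hp0'.le, hh]
            field_simp
          rw [h1]
          have h3 := one_le_norm_intVec z.2
          refine (hdec _ (one_le_mul_of_one_le_of_one_le hp2 h3)).trans (le_of_eq ?_)
          rw [mul_pow, mul_inv, ENNReal.ofReal_mul (by positivity)]
      _ ≤ _ := by
          rw [ENNReal.tsum_mul_left, ENNReal.tsum_mul_left]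
          gcongr
          exact ENNReal.tsum_comp_le_tsum_of_injective Subtype.val_injective
            fun x : Fin (m + 1) → ℤ => ENNReal.ofReal ((‖intVec x‖ ^ (m + 1 + 1))⁻¹)
  have hmain := lattice_sum_le_lintegral hφ hφ1 hhp hp3 le_rfl
  have hone : (p : ENNReal) ^ m * (ENNReal.ofReal γ⁻¹ * ENNReal.ofReal (h p ^ (m + 1))) = 1 := by
    rw [hhn p hp0, ← ENNReal.ofReal_mul (by positivity), ← ENNReal.ofReal_natCast,
      ← ENNReal.ofReal_pow (by positivity), ← ENNReal.ofReal_mul (by positivity)]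
    rw [← ENNReal.ofReal_one]
    congr 1
    field_simp
  have htotal : ∑ a : Fin m → Fin p, ∑' y : {y : Fin (m + 1) → ℤ // y ≠ 0},
      φ (h p * ‖intVec (skewVec p a y.1)‖) < (p : ENNReal) ^ m := by
    refine hsum.trans_lt ?_
    calc _ ≤ (p : ENNReal) ^ m * (C * (ENNReal.ofReal ((R p ^ (m + 1 + 1))⁻¹) * Z)) +
          (p : ENNReal) ^ m * (ENNReal.ofReal γ⁻¹ *
            (ENNReal.ofReal (((1 - h p * (m + 1 : ℕ)) ^ (m + 1))⁻¹) * I)) := by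
          gcongr
          calc _ = (p : ENNReal) ^ m * (ENNReal.ofReal γ⁻¹ * (ENNReal.ofReal (h p ^ (m + 1)) *
                ∑' x : Fin (m + 1) → ℤ, φ (h p * ‖intVec x‖))) := by
                rw [← mul_assoc (ENNReal.ofReal γ⁻¹), ← mul_assoc, hone, one_mul]
            _ ≤ _ := by gcongr
      _ < _ := by
          rw [← mul_add]
          calc _ < (p : ENNReal) ^ m * 1 :=
                (ENNReal.mul_lt_mul_iff_right (by simpa using fun h => absurd h hp0)
                  (by finiteness)).2 hp1
            _ = _ := mul_one _
  obtain ⟨a, ha⟩ : ∃ a : Fin m → Fin p, ∑' y : {y : Fin (m + 1) → ℤ // y ≠ 0},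
      φ (h p * ‖intVec (skewVec p a y.1)‖) < 1 := by
    by_contra! hcon
    refine absurd htotal (not_lt.2 ?_)
    refine le_trans (le_of_eq ?_) (Finset.sum_le_sum fun a _ => hcon a)
    rw [Finset.sum_const, Finset.card_univ, Fintype.card_fun, Fintype.card_fin, Fintype.card_fin,
      nsmul_eq_mul]
    push_cast
    rw [mul_one]
  refine ⟨h p • skewMatrix p a, ?_, ?_⟩
  · rw [Matrix.det_smul, det_skewMatrix, Fintype.card_fin, hhn p hp0]
    field_simp
  · convert ha using 4 with y
    rw [Matrix.smul_mulVec, skewMatrix_mulVec, WithLp.toLp_smul, norm_smul,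
      Real.norm_of_nonneg hhp.le]
    rfl

/-- The volume of a packed ball is at most the covolume. -/
lemma volume_ball_le_abs_det {n : ℕ} (T : Euc n ≃ₗ[ℝ] Euc n) {r : ℝ}
    (hT : (T '' intPoints n).Pairwise
      fun x y => Disjoint (Metric.ball x r) (Metric.ball y r)) :
    volume (Metric.ball (0 : Euc n) r) ≤
      ENNReal.ofReal |LinearMap.det (T : Euc n →ₗ[ℝ] Euc n)| := by
  set e := EuclideanSpace.basisFun (Fin n) ℝ with he
  set b := e.toBasis.map T with hb
  have hvol : volume (ZSpan.fundamentalDomain b) =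
      ENNReal.ofReal |LinearMap.det (T : Euc n →ₗ[ℝ] Euc n)| := by
    rw [hb, ← ZSpan.map_fundamentalDomain]
    have h1 := Measure.addHaar_image_linearMap volume (T : Euc n →ₗ[ℝ] Euc n)
      (ZSpan.fundamentalDomain e.toBasis)
    have h2 : volume (ZSpan.fundamentalDomain e.toBasis) = 1 := by
      rw [measure_congr (ZSpan.fundamentalDomain_ae_parallelepiped e.toBasis volume)]
      simpa using e.volume_parallelepiped
    rw [h2, mul_one] at h1
    exact h1
  by_contra! hlt
  rw [← hvol] at hlt
  set L := (Submodule.span ℤ (range b)).toAddSubgroup with hL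
  have : Countable L := inferInstanceAs (Countable (Submodule.span ℤ (range b)))
  obtain ⟨x, y, hxy, hnd⟩ := exists_pair_mem_lattice_not_disjoint_vadd
    (ZSpan.isAddFundamentalDomain' b volume) measurableSet_ball.nullMeasurableSet hlt
  have hmem : ∀ x : L, (x : Euc n) ∈ T '' intPoints n := by
    intro x
    refine ⟨T.symm x, fun i => ?_, by simp⟩
    have h1 := (b.mem_span_iff_repr_mem ℤ (x : Euc n)).1 x.2 i
    obtain ⟨m, hm⟩ := h1
    refine ⟨m, ?_⟩
    have h2 : b.repr (x : Euc n) i = T.symm (x : Euc n) i := by simp [hb, he]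
    rw [← h2, ← hm]
    rfl
  apply hnd
  have h3 := hT (hmem x) (hmem y) (fun h => hxy (Subtype.ext h))
  have h4 : ∀ z : L, z +ᵥ Metric.ball (0 : Euc n) r =
      Metric.ball (z : Euc n) r := by
    intro z
    have : z +ᵥ Metric.ball (0 : Euc n) r = (z : Euc n) +ᵥ Metric.ball (0 : Euc n) r := rfl
    rw [this, Metric.vadd_ball, vadd_eq_add, add_zero]
  simp only [h4]
  exact h3

lemma bddAbove_packingDensities (n : ℕ) : BddAbove (packingDensities n) := by
  refine ⟨1, ?_⟩
  rintro d ⟨T, r, -, hT, rfl⟩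
  have hdet : 0 < |LinearMap.det (T : Euc n →ₗ[ℝ] Euc n)| :=
    abs_pos.2 (LinearEquiv.isUnit_det' T).ne_zero
  rw [div_le_one hdet]
  exact ENNReal.toReal_le_of_le_ofReal hdet.le (volume_ball_le_abs_det T hT)

lemma exists_intVec_of_mem_intPoints {n : ℕ} {x : Euc n} (hx : x ∈ intPoints n) :
    ∃ z : Fin n → ℤ, x = intVec z := by
  choose z hz using hx
  exact ⟨z, by ext i; simp [hz]⟩

/-- If the lattice has minimum at least one, balls of radius one half are disjoint. -/
lemma pairwise_disjoint_ball_of_one_le_norm {n : ℕ} (T : Euc n ≃ₗ[ℝ] Euc n)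
    (hT : ∀ z : Fin n → ℤ, z ≠ 0 → 1 ≤ ‖T (intVec z)‖) :
    (T '' intPoints n).Pairwise
      fun x y => Disjoint (Metric.ball x (1 / 2)) (Metric.ball y (1 / 2)) := by
  rintro _ ⟨x, hx, rfl⟩ _ ⟨y, hy, rfl⟩ hxy
  obtain ⟨x, rfl⟩ := exists_intVec_of_mem_intPoints hx
  obtain ⟨y, rfl⟩ := exists_intVec_of_mem_intPoints hy
  apply Metric.ball_disjoint_ball
  have hne : x - y ≠ 0 := by
    intro h
    rw [sub_eq_zero.1 h] at hxy
    exact hxy rfl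
  have h1 : intVec (x - y) = intVec x - intVec y := by
    ext i
    simp
  have h2 := hT _ hne
  rw [h1, map_sub, ← dist_eq_norm] at h2
  linarith

/-- The quadratic form of a matrix. -/
def quadForm {n : ℕ} (A : Matrix (Fin n) (Fin n) ℝ) (v : Fin n → ℝ) : ℝ := v ⬝ᵥ A *ᵥ v

/-- The real vector with given integer coordinates. -/
abbrev castVec {n : ℕ} (x : Fin n → ℤ) : Fin n → ℝ := fun i => (x i : ℝ)

lemma quadForm_add {n : ℕ} (A B : Matrix (Fin n) (Fin n) ℝ) (v : Fin n → ℝ) :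
    quadForm (A + B) v = quadForm A v + quadForm B v := by
  simp [quadForm, Matrix.add_mulVec, dotProduct_add]

lemma quadForm_smul {n : ℕ} (c : ℝ) (A : Matrix (Fin n) (Fin n) ℝ) (v : Fin n → ℝ) :
    quadForm (c • A) v = c * quadForm A v := by
  simp [quadForm, Matrix.smul_mulVec]

lemma quadForm_conj {n : ℕ} (S D : Matrix (Fin n) (Fin n) ℝ) (v : Fin n → ℝ) :
    quadForm (Sᵀ * D * S) v = quadForm D (S *ᵥ v) := by
  simp only [quadForm, ← Matrix.mulVec_mulVec]
  rw [Matrix.dotProduct_mulVec v, Matrix.vecMul_transpose]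

lemma quadForm_one {n : ℕ} (v : Fin n → ℝ) :
    quadForm 1 v = ‖(WithLp.toLp 2 v : Euc n)‖ ^ 2 := by
  rw [EuclideanSpace.real_norm_sq_eq]
  simp [quadForm, dotProduct, sq]

lemma quadForm_transpose_mul_self {n : ℕ} (S : Matrix (Fin n) (Fin n) ℝ) (v : Fin n → ℝ) :
    quadForm (Sᵀ * S) v = ‖(WithLp.toLp 2 (S *ᵥ v) : Euc n)‖ ^ 2 := by
  rw [← quadForm_one, ← quadForm_conj, Matrix.mul_one]

lemma continuous_quadForm {n : ℕ} (v : Fin n → ℝ) :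
    Continuous fun A : Matrix (Fin n) (Fin n) ℝ => quadForm A v := by
  unfold quadForm
  fun_prop

lemma quadForm_nonneg {n : ℕ} {A : Matrix (Fin n) (Fin n) ℝ} (hA : A.PosSemidef)
    (v : Fin n → ℝ) : 0 ≤ quadForm A v := by
  simpa [quadForm] using hA.dotProduct_mulVec_nonneg v

lemma quadForm_pos {n : ℕ} {A : Matrix (Fin n) (Fin n) ℝ} (hA : A.PosDef)
    {v : Fin n → ℝ} (hv : v ≠ 0) : 0 < quadForm A v := by
  simpa [quadForm] using hA.dotProduct_mulVec_pos hv

lemma posSemidef_of_quadForm {n : ℕ} {A : Matrix (Fin n) (Fin n) ℝ} (hA : Aᵀ = A)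
    (h : ∀ v, 0 ≤ quadForm A v) : A.PosSemidef :=
  .of_dotProduct_mulVec_nonneg (by simpa [Matrix.IsHermitian] using hA)
    fun v => by simpa [quadForm] using h v

open scoped MatrixOrder in
lemma exists_eq_transpose_mul_self {n : ℕ} {A : Matrix (Fin n) (Fin n) ℝ} (hA : A.PosSemidef) :
    ∃ S : Matrix (Fin n) (Fin n) ℝ, A = Sᵀ * S := by
  obtain ⟨S, hS⟩ := CStarAlgebra.nonneg_iff_eq_star_mul_self.mp hA.nonneg
  exact ⟨S, by rw [hS, Matrix.star_eq_conjTranspose, Matrix.conjTranspose_eq_transpose_of_trivial]⟩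

/-- The quadratic form is at least one on nonzero integer vectors. -/
def IsAdmissible {n : ℕ} (A : Matrix (Fin n) (Fin n) ℝ) : Prop :=
  A.PosSemidef ∧ ∀ x : Fin n → ℤ, x ≠ 0 → 1 ≤ quadForm A (castVec x)

/-- The volume of a ball of radius one half. -/
def halfBallVolume (n : ℕ) : ℝ := (volume (Metric.ball (0 : Euc n) (1 / 2))).toReal

lemma halfBallVolume_pos (n : ℕ) : 0 < halfBallVolume n :=
  ENNReal.toReal_pos (Metric.measure_ball_pos _ _ (by norm_num)).ne' measure_ball_lt_top.ne

/-- The packing attached to a nondegenerate admissible quadratic form. -/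
lemma exists_linearEquiv_of_isAdmissible {n : ℕ} {A : Matrix (Fin n) (Fin n) ℝ}
    (hA : IsAdmissible A) (hdet : A.det ≠ 0) :
    ∃ T : Euc n ≃ₗ[ℝ] Euc n, ((T '' intPoints n).Pairwise
      fun x y => Disjoint (Metric.ball x (1 / 2)) (Metric.ball y (1 / 2))) ∧
      |LinearMap.det (T : Euc n →ₗ[ℝ] Euc n)| = √A.det := by
  obtain ⟨S, rfl⟩ := exists_eq_transpose_mul_self hA.1
  have hS : LinearMap.det (Matrix.toEuclideanLin S) = S.det := by
    rw [Matrix.toEuclideanLin_eq_toLin_orthonormal, LinearMap.det_toLin]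
  have hS0 : LinearMap.det (Matrix.toEuclideanLin S) ≠ 0 := by
    rw [hS]
    rintro h
    simp [h] at hdet
  refine ⟨(Matrix.toEuclideanLin S).equivOfDetNeZero hS0, ?_, ?_⟩
  · refine pairwise_disjoint_ball_of_one_le_norm _ fun z hz => ?_
    have h1 := hA.2 z hz
    rw [quadForm_transpose_mul_self] at h1
    have h2 : (Matrix.toEuclideanLin S).equivOfDetNeZero hS0 (intVec z) =
        (WithLp.toLp 2 (S *ᵥ castVec z) : Euc n) := rfl
    rw [h2]
    exact (one_le_sq_iff₀ (norm_nonneg _)).1 h1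
  · have h3 : (((Matrix.toEuclideanLin S).equivOfDetNeZero hS0 : Euc n ≃ₗ[ℝ] Euc n) :
        Euc n →ₗ[ℝ] Euc n) = Matrix.toEuclideanLin S := rfl
    rw [h3, hS, Matrix.det_mul, Matrix.det_transpose, Real.sqrt_mul_self_eq_abs]

lemma halfBallVolume_div_sqrt_det_mem {n : ℕ} {A : Matrix (Fin n) (Fin n) ℝ}
    (hA : IsAdmissible A) (hdet : A.det ≠ 0) :
    halfBallVolume n / √A.det ∈ packingDensities n := by
  obtain ⟨T, hT, hTd⟩ := exists_linearEquiv_of_isAdmissible hA hdet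
  exact ⟨T, 1 / 2, by norm_num, hT, by rw [hTd]; rfl⟩

lemma sq_halfBallVolume_le_det {n : ℕ} {A : Matrix (Fin n) (Fin n) ℝ}
    (hA : IsAdmissible A) (hdet : A.det ≠ 0) : halfBallVolume n ^ 2 ≤ A.det := by
  obtain ⟨T, hT, hTd⟩ := exists_linearEquiv_of_isAdmissible hA hdet
  have h1 := volume_ball_le_abs_det T hT
  rw [hTd] at h1
  have h2 : halfBallVolume n ≤ √A.det := ENNReal.toReal_le_of_le_ofReal (Real.sqrt_nonneg _) h1
  exact (Real.le_sqrt (halfBallVolume_pos n).le hA.1.det_nonneg).1 h2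

/-- Admissible quadratic forms are uniformly nondegenerate. -/
lemma IsAdmissible.posDef {n : ℕ} {A : Matrix (Fin n) (Fin n) ℝ} (hA : IsAdmissible A) :
    A.PosDef := by
  rw [hA.1.posDef_iff_det_ne_zero]
  have h1 : ∀ t : ℝ, 0 < t → halfBallVolume n ^ 2 ≤ (A + t • 1).det := by
    intro t ht
    have hpd : (A + t • (1 : Matrix (Fin n) (Fin n) ℝ)).PosDef :=
      Matrix.PosDef.posSemidef_add hA.1 (Matrix.PosDef.one.smul ht)
    refine sq_halfBallVolume_le_det ⟨hpd.posSemidef, fun x hx => ?_⟩ hpd.det_pos.ne'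
    rw [quadForm_add, quadForm_smul]
    have h2 := hA.2 x hx
    have h3 := quadForm_nonneg (Matrix.PosSemidef.one (n := Fin n) (R := ℝ)) (castVec x)
    have := mul_nonneg ht.le h3
    linarith
  have hcont : Tendsto (fun t : ℝ => (A + t • (1 : Matrix (Fin n) (Fin n) ℝ)).det) (𝓝[>] 0)
      (𝓝 A.det) := by
    have : Continuous fun t : ℝ => (A + t • (1 : Matrix (Fin n) (Fin n) ℝ)).det := by fun_prop
    have h2 := this.tendsto 0
    simp only [zero_smul, add_zero] at h2
    exact h2.mono_left nhdsWithin_le_nhds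
  have := ge_of_tendsto hcont (by filter_upwards [self_mem_nhdsWithin] with t ht using h1 t ht)
  exact (lt_of_lt_of_le (pow_pos (halfBallVolume_pos n) 2) this).ne'

lemma tendsto_second_difference {h h' : ℝ → ℝ} {u c b : ℝ}
    (hh : ∀ᶠ y in 𝓝 u, HasDerivAt h (h' y) y) (hh' : HasDerivAt h' c u) :
    Tendsto (fun τ => (h (u + τ * b) + h (u - τ * b) - 2 * h u) / τ ^ 2) (𝓝[>] 0)
      (𝓝 (c * b ^ 2)) := by
  have hp : HasDerivAt (fun τ : ℝ => u + τ * b) b 0 := by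
    simpa using ((hasDerivAt_id (0 : ℝ)).mul_const b).const_add u
  have hm : HasDerivAt (fun τ : ℝ => u - τ * b) (-b) 0 := by
    simpa using ((hasDerivAt_id (0 : ℝ)).mul_const b).const_sub u
  have hpt : Tendsto (fun τ : ℝ => u + τ * b) (𝓝 0) (𝓝 u) := by
    simpa using hp.continuousAt.tendsto
  have hmt : Tendsto (fun τ : ℝ => u - τ * b) (𝓝 0) (𝓝 u) := by
    simpa using hm.continuousAt.tendsto
  have hg' : HasDerivAt (fun τ => b * (h' (u + τ * b) - h' (u - τ * b))) (2 * (c * b ^ 2)) 0 := by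
    have h1 : HasDerivAt (fun τ => h' (u + τ * b)) (c * b) 0 :=
      HasDerivAt.comp (h₂ := h') (0 : ℝ) (by simpa using hh') hp
    have h2 : HasDerivAt (fun τ => h' (u - τ * b)) (c * (-b)) 0 :=
      HasDerivAt.comp (h₂ := h') (0 : ℝ) (by simpa using hh') hm
    refine ((h1.sub h2).const_mul b).congr_deriv (by ring)
  have hslope : Tendsto (fun τ => b * (h' (u + τ * b) - h' (u - τ * b)) / (2 * τ)) (𝓝[>] 0)
      (𝓝 (c * b ^ 2)) := by
    have h1 := hg'.tendsto_slope_zero_right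
    have h2 := h1.const_mul (1 / 2 : ℝ)
    refine Tendsto.congr' ?_ (by simpa using h2)
    filter_upwards [self_mem_nhdsWithin] with τ hτ
    have hτ0 : τ ≠ 0 := (mem_Ioi.1 hτ).ne'
    field_simp
  refine HasDerivAt.lhopital_zero_nhdsGT (f' := fun τ => b * (h' (u + τ * b) - h' (u - τ * b)))
    (g' := fun τ => 2 * τ) ?_ ?_ ?_ ?_ ?_ hslope
  · have h1 := (hpt.eventually hh).and (hmt.eventually hh)
    filter_upwards [nhdsWithin_le_nhds h1] with τ hτ
    have hp : HasDerivAt (fun τ : ℝ => u + τ * b) b τ := by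
      simpa using ((hasDerivAt_id τ).mul_const b).const_add u
    have hm : HasDerivAt (fun τ : ℝ => u - τ * b) (-b) τ := by
      simpa using ((hasDerivAt_id τ).mul_const b).const_sub u
    have h2 := ((HasDerivAt.comp (h₂ := h) τ hτ.1 hp).add
      (HasDerivAt.comp (h₂ := h) τ hτ.2 hm)).sub_const (2 * h u)
    exact h2.congr_deriv (by ring)
  · filter_upwards with τ
    simpa using hasDerivAt_pow 2 τ
  · filter_upwards [self_mem_nhdsWithin] with τ hτ
    have := mem_Ioi.1 hτ
    positivity
  · have h1 : ContinuousAt h u := hh.self_of_nhds.continuousAt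
    have h2 := (((h1.tendsto.comp hpt).add (h1.tendsto.comp hmt)).sub_const (2 * h u)).mono_left
      (nhdsWithin_le_nhds (s := Ioi 0))
    have h3 : h u + h u - 2 * h u = 0 := by ring
    simpa only [Function.comp_apply, h3] using h2
  · have : Tendsto (fun τ : ℝ => τ ^ 2) (𝓝 0) (𝓝 0) := by
      simpa using (continuous_pow 2).tendsto (0 : ℝ)
    exact this.mono_left nhdsWithin_le_nhds

lemma nonpos_of_hasDerivAt_of_le {f : ℝ → ℝ} {f' a b : ℝ} (hab : a < b) (hf : HasDerivAt f f' a)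
    (h : ∀ t ∈ Icc a b, f t ≤ f a) : f' ≤ 0 := by
  have h1 := (hasDerivAt_iff_tendsto_slope.1 hf).mono_left
    (nhdsGT_le_nhdsNE a)
  refine le_of_tendsto h1 ?_
  filter_upwards [Ioo_mem_nhdsGT hab] with t ht
  rw [slope_def_field]
  exact div_nonpos_of_nonpos_of_nonneg (sub_nonpos.2 (h t ⟨ht.1.le, ht.2.le⟩))
    (sub_nonneg.2 ht.1.le)

lemma det_le_exp_trace_sub {n : ℕ} {X : Matrix (Fin n) (Fin n) ℝ} (hX : X.PosSemidef) :
    X.det ≤ Real.exp (X.trace - n) := by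
  rw [hX.isHermitian.det_eq_prod_eigenvalues, hX.isHermitian.trace_eq_sum_eigenvalues]
  simp only [RCLike.ofReal_real_eq_id, id]
  have h1 : ∑ i, hX.isHermitian.eigenvalues i - n = ∑ i, (hX.isHermitian.eigenvalues i - 1) := by
    simp
  rw [h1, Real.exp_sum]
  refine Finset.prod_le_prod (fun i _ => hX.eigenvalues_nonneg i) fun i _ => ?_
  have := Real.add_one_le_exp (hX.isHermitian.eigenvalues i - 1)
  linarith

lemma abs_quadForm_le {n : ℕ} (E : Matrix (Fin n) (Fin n) ℝ) (v : Fin n → ℝ) :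
    |quadForm E v| ≤ (∑ i, ∑ j, |E i j|) * ‖v‖ ^ 2 := by
  have h1 : quadForm E v = ∑ i, ∑ j, E i j * (v i * v j) := by
    simp only [quadForm, dotProduct, Matrix.mulVec, Finset.mul_sum]
    exact Finset.sum_congr rfl fun i _ => Finset.sum_congr rfl fun j _ => by ring
  rw [h1, Finset.sum_mul]
  refine (Finset.abs_sum_le_sum_abs _ _).trans (Finset.sum_le_sum fun i _ => ?_)
  rw [Finset.sum_mul]
  refine (Finset.abs_sum_le_sum_abs _ _).trans (Finset.sum_le_sum fun j _ => ?_)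
  rw [abs_mul, abs_mul, sq]
  gcongr
  · exact norm_le_pi_norm v i
  · exact norm_le_pi_norm v j

lemma exists_pos_mul_sq_norm_le_quadForm {n : ℕ} {K : Set (Matrix (Fin n) (Fin n) ℝ)}
    (hK : IsCompact K) (hpd : ∀ A ∈ K, A.PosDef) :
    ∃ l : ℝ, 0 < l ∧ ∀ A ∈ K, ∀ v, l * ‖v‖ ^ 2 ≤ quadForm A v := by
  have hcont : Continuous fun p : Matrix (Fin n) (Fin n) ℝ × (Fin n → ℝ) => quadForm p.1 p.2 := by
    unfold quadForm
    fun_prop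
  rcases (K ×ˢ Metric.sphere (0 : Fin n → ℝ) 1).eq_empty_or_nonempty with h | h
  · refine ⟨1, one_pos, fun A hA v => ?_⟩
    have hv : v = 0 := by
      by_contra hv
      have : (A, ‖v‖⁻¹ • v) ∈ K ×ˢ Metric.sphere (0 : Fin n → ℝ) 1 :=
        ⟨hA, by simp [norm_smul, norm_ne_zero_iff.2 hv]⟩
      rw [h] at this
      exact this
    simp [hv, quadForm]
  · obtain ⟨⟨A₀, v₀⟩, hmem, hmin⟩ :=
      (hK.prod (isCompact_sphere 0 1)).exists_isMinOn h hcont.continuousOn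
    have hv₀ : v₀ ≠ 0 := by
      rintro rfl
      simpa using hmem.2
    refine ⟨quadForm A₀ v₀, quadForm_pos (hpd A₀ hmem.1) hv₀, fun A hA v => ?_⟩
    rcases eq_or_ne v 0 with rfl | hv
    · simp [quadForm]
    have hn : ‖v‖ ≠ 0 := norm_ne_zero_iff.2 hv
    have h1 : quadForm A₀ v₀ ≤ quadForm A (‖v‖⁻¹ • v) :=
      hmin (⟨hA, by simp [norm_smul, hn]⟩ : (A, ‖v‖⁻¹ • v) ∈ K ×ˢ Metric.sphere _ _)
    have h2 : quadForm A (‖v‖⁻¹ • v) = (‖v‖⁻¹) ^ 2 * quadForm A v := by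
      simp only [quadForm, Matrix.mulVec_smul, smul_dotProduct, dotProduct_smul, smul_eq_mul]
      ring
    rw [h2] at h1
    calc _ ≤ (‖v‖⁻¹ ^ 2 * quadForm A v) * ‖v‖ ^ 2 := by gcongr
      _ = _ := by field_simp

lemma finite_setOf_mul_sq_norm_le {n : ℕ} {l : ℝ} (hl : 0 < l) (c : ℝ) :
    {x : Fin n → ℤ | l * ‖castVec x‖ ^ 2 ≤ c}.Finite := by
  refine (finite_Icc (fun _ => -⌈c / l⌉ - 1 : Fin n → ℤ) (fun _ => ⌈c / l⌉ + 1)).subset ?_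
  intro x hx
  have h1 : ‖castVec x‖ ^ 2 ≤ c / l := by
    rw [le_div_iff₀ hl, mul_comm]
    exact hx
  have h2 : ∀ i, |x i| ≤ ⌈c / l⌉ + 1 := by
    intro i
    have h3 : |(x i : ℝ)| ≤ ‖castVec x‖ := norm_le_pi_norm (castVec x) i
    have h4 : |(x i : ℝ)| ≤ ⌈c / l⌉ + 1 := by
      have := Int.le_ceil (c / l)
      nlinarith [sq_nonneg (‖castVec x‖ - 1)]
    exact_mod_cast h4
  constructor <;> intro i <;> have := abs_le.1 (h2 i) <;> simp only <;> linarith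

lemma eventually_posSemidef {n : ℕ} {A E : Matrix (Fin n) (Fin n) ℝ} (hA : A.PosDef)
    (hE : Eᵀ = E) : ∀ᶠ τ in 𝓝 (0 : ℝ), (A + τ • E).PosSemidef := by
  obtain ⟨l, hl, hlA⟩ := exists_pos_mul_sq_norm_le_quadForm (isCompact_singleton (x := A))
    (by simpa using hA)
  set c := ∑ i, ∑ j, |E i j|
  have hev : ∀ᶠ τ in 𝓝 (0 : ℝ), |τ| * c < l := by
    have : Tendsto (fun τ : ℝ => |τ| * c) (𝓝 0) (𝓝 0) := by
      have h : Continuous fun τ : ℝ => |τ| * c := by fun_prop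
      simpa using h.tendsto 0
    exact this.eventually_lt_const hl
  filter_upwards [hev] with τ hτ
  refine posSemidef_of_quadForm ?_ fun v => ?_
  · have := hA.isHermitian.eq
    rw [Matrix.conjTranspose_eq_transpose_of_trivial] at this
    rw [Matrix.transpose_add, Matrix.transpose_smul, hE, this]
  · rw [quadForm_add, quadForm_smul]
    have h1 := hlA A rfl v
    have h2 : |τ * quadForm E v| ≤ |τ| * c * ‖v‖ ^ 2 := by
      rw [abs_mul, mul_assoc]
      exact mul_le_mul_of_nonneg_left (abs_quadForm_le E v) (abs_nonneg τ)
    have h3 : |τ| * c * ‖v‖ ^ 2 ≤ l * ‖v‖ ^ 2 := by gcongr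
    have h4 := neg_abs_le (τ * quadForm E v)
    linarith

/-- Perturbations which are tangent to all contact constraints preserve admissibility. -/
lemma eventually_isAdmissible {n : ℕ} {A E : Matrix (Fin n) (Fin n) ℝ} (hA : IsAdmissible A)
    (hE : Eᵀ = E)
    (hcontact : ∀ x : Fin n → ℤ, x ≠ 0 → quadForm A (castVec x) = 1 → quadForm E (castVec x) = 0) :
    ∀ᶠ τ in 𝓝 (0 : ℝ), IsAdmissible (A + τ • E) := by
  obtain ⟨l, hl, hlA⟩ := exists_pos_mul_sq_norm_le_quadForm (isCompact_singleton (x := A))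
    (by simpa using hA.posDef)
  set c := ∑ i, ∑ j, |E i j|
  have hev : ∀ᶠ τ in 𝓝 (0 : ℝ), |τ| * c < l / 2 := by
    have : Tendsto (fun τ : ℝ => |τ| * c) (𝓝 0) (𝓝 0) := by
      have h : Continuous fun τ : ℝ => |τ| * c := by fun_prop
      simpa using h.tendsto 0
    exact this.eventually_lt_const (by positivity)
  have hfin : ∀ᶠ τ in 𝓝 (0 : ℝ), ∀ x ∈ {x : Fin n → ℤ | l * ‖castVec x‖ ^ 2 ≤ 2}, x ≠ 0 →
      1 ≤ quadForm (A + τ • E) (castVec x) := by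
    rw [(finite_setOf_mul_sq_norm_le hl 2).eventually_all]
    intro x _
    rcases eq_or_ne x 0 with hx | hx
    · exact Eventually.of_forall fun τ h => absurd hx h
    rcases (hA.2 x hx).eq_or_lt with h1 | h1
    · refine Eventually.of_forall fun τ _ => ?_
      rw [quadForm_add, quadForm_smul, hcontact x hx h1.symm, ← h1]
      simp
    · have h2 : Continuous fun τ : ℝ => quadForm (A + τ • E) (castVec x) := by
        simp only [quadForm_add, quadForm_smul]
        fun_prop
      have h3 := h2.tendsto 0
      simp only [zero_smul, add_zero] at h3
      filter_upwards [h3.eventually_const_lt h1] with τ hτ _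
      exact hτ.le
  filter_upwards [hev, hfin, eventually_posSemidef hA.posDef hE] with τ h1 h2 h3
  refine ⟨h3, fun x hx => ?_⟩
  rcases le_or_gt (l * ‖castVec x‖ ^ 2) 2 with h | h
  · exact h2 x h hx
  · rw [quadForm_add, quadForm_smul]
    have h4 := hlA A rfl (castVec x)
    have h5 : |τ * quadForm E (castVec x)| ≤ |τ| * c * ‖castVec x‖ ^ 2 := by
      rw [abs_mul, mul_assoc]
      exact mul_le_mul_of_nonneg_left (abs_quadForm_le E _) (abs_nonneg τ)
    have h6 : |τ| * c * ‖castVec x‖ ^ 2 ≤ l / 2 * ‖castVec x‖ ^ 2 := by gcongr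
    have h7 := neg_abs_le (τ * quadForm E (castVec x))
    linarith

/-- The matrix with entries given by a point of a Euclidean space. -/
def matOf {n : ℕ} (d : EuclideanSpace ℝ (Fin n × Fin n)) : Matrix (Fin n) (Fin n) ℝ :=
  Matrix.of fun i j => d (i, j)

lemma matOf_add {n : ℕ} (d e : EuclideanSpace ℝ (Fin n × Fin n)) :
    matOf (d + e) = matOf d + matOf e := rfl

lemma matOf_smul {n : ℕ} (c : ℝ) (d : EuclideanSpace ℝ (Fin n × Fin n)) :
    matOf (c • d) = c • matOf d := rfl

lemma trace_matOf_mul_self {n : ℕ} {d : EuclideanSpace ℝ (Fin n × Fin n)}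
    (hd : (matOf d)ᵀ = matOf d) : (matOf d * matOf d).trace = ‖d‖ ^ 2 := by
  rw [EuclideanSpace.real_norm_sq_eq, Fintype.sum_prod_type]
  simp only [Matrix.trace, Matrix.diag, Matrix.mul_apply]
  refine Finset.sum_congr rfl fun i _ => Finset.sum_congr rfl fun j _ => ?_
  have h1 : matOf d j i = matOf d i j := congrFun (congrFun hd i) j
  rw [h1, sq]
  rfl

lemma sum_sq_quadForm_le {n k : ℕ} {D : Fin k → EuclideanSpace ℝ (Fin n × Fin n)}
    (hD : Orthonormal ℝ D) (w : Fin n → ℝ) :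
    ∑ i, quadForm (matOf (D i)) w ^ 2 ≤ (w ⬝ᵥ w) ^ 2 := by
  set e : EuclideanSpace ℝ (Fin n × Fin n) := WithLp.toLp 2 fun p => w p.1 * w p.2 with he
  have h1 : ∀ d : EuclideanSpace ℝ (Fin n × Fin n), quadForm (matOf d) w = inner ℝ d e := by
    intro d
    rw [PiLp.inner_apply, Fintype.sum_prod_type]
    simp only [quadForm, dotProduct, Matrix.mulVec, Finset.mul_sum]
    refine Finset.sum_congr rfl fun i _ => Finset.sum_congr rfl fun j _ => ?_
    simp [he, matOf]
    ring
  have h2 : ‖e‖ ^ 2 = (w ⬝ᵥ w) ^ 2 := by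
    rw [EuclideanSpace.real_norm_sq_eq, Fintype.sum_prod_type, sq (w ⬝ᵥ w), dotProduct,
      Finset.sum_mul_sum]
    refine Finset.sum_congr rfl fun i _ => Finset.sum_congr rfl fun j _ => ?_
    simp [he]
    ring
  rw [← h2]
  refine le_trans (le_of_eq ?_) (hD.sum_inner_products_le e (s := Finset.univ))
  refine Finset.sum_congr rfl fun i _ => ?_
  rw [h1, Real.norm_eq_abs, sq_abs]

lemma two_mul_card_lt_add_le (n : ℕ) :
    2 * Fintype.card {p : Fin n × Fin n // p.1 < p.2} + n ≤ n * n := by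
  let f : {p : Fin n × Fin n // p.1 < p.2} ⊕ {p : Fin n × Fin n // p.1 < p.2} ⊕ Fin n →
      Fin n × Fin n :=
    Sum.elim (fun p => p.1) (Sum.elim (fun p => p.1.swap) fun i => (i, i))
  have hf : Function.Injective f := by
    rintro (⟨⟨a, b⟩, h⟩ | ⟨⟨a, b⟩, h⟩ | a) (⟨⟨c, d⟩, h'⟩ | ⟨⟨c, d⟩, h'⟩ | c) heq <;>
      simp only [f, Sum.elim_inl, Sum.elim_inr, Prod.swap, Prod.mk.injEq] at heq <;>
      grind
  have := Fintype.card_le_of_injective f hf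
  simp only [Fintype.card_sum, Fintype.card_fin, Fintype.card_prod] at this
  omega

/-- There are many orthonormal symmetric directions satisfying given linear constraints. -/
lemma exists_orthonormal_directions {n : ℕ} (S : Matrix (Fin n) (Fin n) ℝ)
    (H : Finset (Fin n → ℤ)) :
    ∃ (k : ℕ) (D : Fin k → EuclideanSpace ℝ (Fin n × Fin n)), Orthonormal ℝ D ∧
      n * (n + 1) ≤ 2 * (k + H.card + 1) ∧
      ∀ i, (matOf (D i))ᵀ = matOf (D i) ∧ (Sᵀ * matOf (D i) * S).trace = 0 ∧
        ∀ x ∈ H, quadForm (matOf (D i)) (S *ᵥ castVec x) = 0 := by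
  let L : EuclideanSpace ℝ (Fin n × Fin n) →ₗ[ℝ]
      ({p : Fin n × Fin n // p.1 < p.2} → ℝ) × ℝ × (H → ℝ) :=
    { toFun := fun d => (fun p => d (p.1.1, p.1.2) - d (p.1.2, p.1.1),
        (Sᵀ * matOf d * S).trace, fun x => quadForm (matOf d) (S *ᵥ castVec x.1))
      map_add' := by
        intro d e
        simp only [matOf_add, Matrix.mul_add, Matrix.add_mul, Matrix.trace_add, quadForm_add]
        refine Prod.ext ?_ rfl
        funext p
        simp
        ring
      map_smul' := by
        intro c d
        simp only [matOf_smul, Matrix.mul_smul, Matrix.smul_mul, Matrix.trace_smul, quadForm_smul]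
        refine Prod.ext ?_ rfl
        funext p
        simp
        ring }
  have hL : ∀ d, L d = (fun p => d (p.1.1, p.1.2) - d (p.1.2, p.1.1),
        (Sᵀ * matOf d * S).trace, fun x => quadForm (matOf d) (S *ᵥ castVec x.1)) := fun d => rfl
  set F := LinearMap.ker L with hF
  refine ⟨Module.finrank ℝ F, fun i => ((stdOrthonormalBasis ℝ F) i).1, ?_, ?_, fun i => ?_⟩
  · exact (stdOrthonormalBasis ℝ F).orthonormal.comp_linearIsometry F.subtypeₗᵢ
  · have h1 := L.finrank_range_add_finrank_ker
    have h2 : Module.finrank ℝ (LinearMap.range L) ≤ _ := Submodule.finrank_le _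
    rw [Module.finrank_prod, Module.finrank_prod, Module.finrank_fintype_fun_eq_card,
      Module.finrank_fintype_fun_eq_card, Module.finrank_self, Fintype.card_coe] at h2
    rw [finrank_euclideanSpace, Fintype.card_prod, Fintype.card_fin, ← hF] at h1
    have h3 := two_mul_card_lt_add_le n
    nlinarith
  · have h1 : L ((stdOrthonormalBasis ℝ F) i).1 = 0 := ((stdOrthonormalBasis ℝ F) i).2
    set d : EuclideanSpace ℝ (Fin n × Fin n) :=
      ((stdOrthonormalBasis ℝ F) i).1
    rw [hL] at h1
    obtain ⟨h2, h3⟩ := Prod.ext_iff.1 h1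
    obtain ⟨h4, h5⟩ := Prod.ext_iff.1 h3
    simp only [Prod.fst_zero, Prod.snd_zero] at h2 h4 h5
    refine ⟨?_, h4, fun x hx => congrFun h5 ⟨x, hx⟩⟩
    ext a b
    simp only [Matrix.transpose_apply, matOf, Matrix.of_apply]
    rcases lt_trichotomy a b with h | h | h
    · have := congrFun h2 ⟨(a, b), h⟩
      simp only [Pi.zero_apply] at this
      linarith
    · rw [h]
    · have := congrFun h2 ⟨(b, a), h⟩
      simp only [Pi.zero_apply] at this
      linarith

lemma eventually_sq_mul_le_neg_log_det {n : ℕ} {d : EuclideanSpace ℝ (Fin n × Fin n)}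
    (hd : (matOf d)ᵀ = matOf d) : ∀ᶠ τ in 𝓝 (0 : ℝ),
      0 < (1 + τ • matOf d).det ∧ 0 < (1 - τ • matOf d).det ∧
      τ ^ 2 * ‖d‖ ^ 2 ≤ -Real.log (1 + τ • matOf d).det - Real.log (1 - τ • matOf d).det := by
  set D := matOf d
  have hp : Tendsto (fun τ : ℝ => (1 + τ • D).det) (𝓝 0) (𝓝 1) := by
    have h : Continuous fun τ : ℝ => (1 + τ • D).det := by fun_prop
    simpa using h.tendsto 0
  have hm : Tendsto (fun τ : ℝ => (1 - τ • D).det) (𝓝 0) (𝓝 1) := by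
    have h : Continuous fun τ : ℝ => (1 - τ • D).det := by fun_prop
    simpa using h.tendsto 0
  have hsq : Tendsto (fun τ : ℝ => τ ^ 2) (𝓝 0) (𝓝 0) := by
    simpa using (continuous_pow 2).tendsto (0 : ℝ)
  have hpsd := hsq.eventually (eventually_posSemidef (A := (1 : Matrix (Fin n) (Fin n) ℝ))
    (E := -(D * D)) Matrix.PosDef.one (by rw [Matrix.transpose_neg, Matrix.transpose_mul, hd]))
  filter_upwards [hp.eventually_const_lt one_pos, hm.eventually_const_lt one_pos, hpsd]
    with τ h1 h2 h3
  refine ⟨h1, h2, ?_⟩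
  have hmul : (1 + τ • D) * (1 - τ • D) = 1 + τ ^ 2 • (-(D * D)) := by
    rw [smul_neg, sq, ← smul_smul, mul_sub, add_mul, add_mul]
    simp only [mul_one, one_mul, smul_mul_assoc, mul_smul_comm]
    abel
  have h4 := det_le_exp_trace_sub h3
  rw [← hmul, Matrix.det_mul, hmul, Matrix.trace_add, Matrix.trace_one, Fintype.card_fin,
    Matrix.trace_smul, Matrix.trace_neg, trace_matOf_mul_self hd] at h4
  have h5 := Real.log_le_log (mul_pos h1 h2) h4
  rw [Real.log_exp, Real.log_mul h1.ne' h2.ne', smul_eq_mul] at h5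
  linarith

/-- The functional which is maximised along the evolution. -/
def latticeFunctional {n : ℕ} (F : Finset (Fin n → ℤ)) (s : ℝ) (A : Matrix (Fin n) (Fin n) ℝ) :
    ℝ :=
  -Real.log A.det - 2 * ∑ x ∈ F, heatPot s (Real.log (quadForm A (castVec x)))

lemma sq_norm_le_of_maximal {n : ℕ} {F : Finset (Fin n → ℤ)} (hF0 : 0 ∉ F) {s : ℝ} (hs : 0 < s)
    {S : Matrix (Fin n) (Fin n) ℝ} (hA : IsAdmissible (Sᵀ * S))
    (hmax : ∀ B : Matrix (Fin n) (Fin n) ℝ, IsAdmissible B → B.trace = (Sᵀ * S).trace →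
      latticeFunctional F s B ≤ latticeFunctional F s (Sᵀ * S))
    {d : EuclideanSpace ℝ (Fin n × Fin n)} (hd : (matOf d)ᵀ = matOf d)
    (htr : (Sᵀ * matOf d * S).trace = 0)
    (hcontact : ∀ x : Fin n → ℤ, x ≠ 0 → quadForm (Sᵀ * S) (castVec x) = 1 →
      quadForm (matOf d) (S *ᵥ castVec x) = 0) :
    ‖d‖ ^ 2 ≤ 4 * ∑ x ∈ F, heatRate s (Real.log (quadForm (Sᵀ * S) (castVec x))) /
      quadForm (Sᵀ * S) (castVec x) ^ 2 * quadForm (matOf d) (S *ᵥ castVec x) ^ 2 := by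
  set D := matOf d with hDdef
  set E := Sᵀ * D * S with hE
  have hEt : Eᵀ = E := by
    rw [hE, Matrix.transpose_mul, Matrix.transpose_mul, Matrix.transpose_transpose, hd,
      Matrix.mul_assoc]
  set u : (Fin n → ℤ) → ℝ := fun x => quadForm (Sᵀ * S) (castVec x) with hu
  set b : (Fin n → ℤ) → ℝ := fun x => quadForm D (S *ᵥ castVec x) with hb
  have hEq : ∀ x, quadForm E (castVec x) = b x := fun x => quadForm_conj S D _
  set h : ℝ → ℝ := fun y => heatPot s (Real.log y)
  have hadm := eventually_isAdmissible hA hEt (by simpa only [hEq] using hcontact)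
  have hneg : Tendsto (fun τ : ℝ => -τ) (𝓝 0) (𝓝 0) := by
    simpa using continuous_neg.tendsto (0 : ℝ)
  have hadm' := hneg.eventually hadm
  have hdet : ∀ τ : ℝ, (Sᵀ * S + τ • E).det = (Sᵀ * S).det * (1 + τ • D).det := by
    intro τ
    have : Sᵀ * S + τ • E = Sᵀ * (1 + τ • D) * S := by
      rw [hE]
      simp [Matrix.mul_add, Matrix.add_mul]
    rw [this, Matrix.det_mul, Matrix.det_mul, Matrix.det_mul]
    ring
  have hdet0 : (Sᵀ * S).det ≠ 0 := hA.posDef.det_pos.ne'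
  have hev : ∀ᶠ τ in 𝓝[>] (0 : ℝ), ‖d‖ ^ 2 ≤
      2 * ∑ x ∈ F, (h (u x + τ * b x) + h (u x - τ * b x) - 2 * h (u x)) / τ ^ 2 := by
    filter_upwards [nhdsWithin_le_nhds hadm, nhdsWithin_le_nhds hadm',
      nhdsWithin_le_nhds (eventually_sq_mul_le_neg_log_det hd), self_mem_nhdsWithin]
      with τ h1 h2 h3 h4
    have hτ : 0 < τ := h4
    have htrτ : ∀ t : ℝ, (Sᵀ * S + t • E).trace = (Sᵀ * S).trace := by
      intro t
      rw [Matrix.trace_add, Matrix.trace_smul, htr, smul_zero, add_zero]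
    have h5 := hmax _ h1 (htrτ τ)
    have h6 := hmax _ h2 (htrτ (-τ))
    have h7 : (1 + (-τ) • D) = 1 - τ • D := by rw [neg_smul, sub_eq_add_neg]
    simp only [latticeFunctional, quadForm_add, quadForm_smul, hEq, hdet, h7] at h5 h6
    rw [Real.log_mul hdet0 h3.1.ne'] at h5
    rw [Real.log_mul hdet0 h3.2.1.ne'] at h6
    have h8 : ∀ x, u x + -τ * b x = u x - τ * b x := fun x => by ring
    change _ - 2 * ∑ x ∈ F, h (u x + -τ * b x) ≤ _ - 2 * ∑ x ∈ F, h (u x) at h6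
    change _ - 2 * ∑ x ∈ F, h (u x + τ * b x) ≤ _ - 2 * ∑ x ∈ F, h (u x) at h5
    simp only [h8] at h6
    rw [← Finset.sum_div, Finset.sum_sub_distrib, Finset.sum_add_distrib, ← Finset.mul_sum,
      ← mul_div_assoc, le_div_iff₀ (by positivity)]
    linarith [h3.2.2]
  have hlim : Tendsto (fun τ => 2 * ∑ x ∈ F,
      (h (u x + τ * b x) + h (u x - τ * b x) - 2 * h (u x)) / τ ^ 2) (𝓝[>] 0)
      (𝓝 (2 * ∑ x ∈ F, 2 * heatRate s (Real.log (u x)) / u x ^ 2 * b x ^ 2)) := by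
    refine (tendsto_finsetSum _ fun x hx => ?_).const_mul 2
    have hu0 : 0 < u x := lt_of_lt_of_le one_pos (hA.2 x (by rintro rfl; exact hF0 hx))
    refine tendsto_second_difference
      (h' := fun u => -(√s * gaussRamp (√s / 2 - Real.log u / √s)) / u)
      ?_ (hasDerivAt_deriv_heatPot_log hs hu0)
    filter_upwards [lt_mem_nhds hu0] with y hy using hasDerivAt_heatPot_log hs hy
  refine (ge_of_tendsto hlim hev).trans (le_of_eq ?_)
  rw [Finset.mul_sum, Finset.mul_sum]
  refine Finset.sum_congr rfl fun x _ => ?_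
  ring

/-- At a maximum of the functional, the total heat rate is bounded below. -/
lemma le_sum_heatRate_of_maximal {n : ℕ} {F : Finset (Fin n → ℤ)} (hF0 : 0 ∉ F) {s : ℝ}
    (hs : 0 < s) {A : Matrix (Fin n) (Fin n) ℝ} (hA : IsAdmissible A)
    (hF : ∀ x : Fin n → ℤ, x ≠ 0 → quadForm A (castVec x) = 1 → x ∈ F)
    (hmax : ∀ B : Matrix (Fin n) (Fin n) ℝ, IsAdmissible B → B.trace = A.trace →
      latticeFunctional F s B ≤ latticeFunctional F s A) :
    (n : ℝ) * (n + 1) / 2 - 1 ≤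
      4 * ∑ x ∈ F, heatRate s (Real.log (quadForm A (castVec x))) := by
  obtain ⟨S, rfl⟩ := exists_eq_transpose_mul_self hA.1
  set u : (Fin n → ℤ) → ℝ := fun x => quadForm (Sᵀ * S) (castVec x) with hu
  classical
  set H := F.filter fun x => u x = 1 with hH
  obtain ⟨k, D, hD, hk, hDi⟩ := exists_orthonormal_directions S H
  have hdir : ∀ i, 1 ≤ 4 * ∑ x ∈ F, heatRate s (Real.log (u x)) / u x ^ 2 *
      quadForm (matOf (D i)) (S *ᵥ castVec x) ^ 2 := by
    intro i
    have h1 := sq_norm_le_of_maximal hF0 hs hA hmax (hDi i).1 (hDi i).2.1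
      (fun x hx0 hx => (hDi i).2.2 x (Finset.mem_filter.2 ⟨hF x hx0 hx, hx⟩))
    rwa [hD.1 i, one_pow] at h1
  have hupos : ∀ x ∈ F, 0 < u x := fun x hx =>
    lt_of_lt_of_le one_pos (hA.2 x (by rintro rfl; exact hF0 hx))
  have hsum : (k : ℝ) ≤ 4 * ∑ x ∈ F, if u x = 1 then 0 else heatRate s (Real.log (u x)) := by
    calc (k : ℝ) = ∑ _i : Fin k, (1 : ℝ) := by simp
      _ ≤ ∑ i, 4 * ∑ x ∈ F, heatRate s (Real.log (u x)) / u x ^ 2 *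
            quadForm (matOf (D i)) (S *ᵥ castVec x) ^ 2 := Finset.sum_le_sum fun i _ => hdir i
      _ = 4 * ∑ x ∈ F, heatRate s (Real.log (u x)) / u x ^ 2 *
            ∑ i, quadForm (matOf (D i)) (S *ᵥ castVec x) ^ 2 := by
          rw [← Finset.mul_sum, Finset.sum_comm]
          simp only [Finset.mul_sum]
      _ ≤ _ := by
          gcongr with x hx
          split_ifs with h1
          · refine le_of_eq ?_
            rw [Finset.sum_eq_zero, mul_zero]
            intro i _
            rw [(hDi i).2.2 x (Finset.mem_filter.2 ⟨hx, h1⟩)]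
            norm_num
          · have h2 := sum_sq_quadForm_le hD (S *ᵥ castVec x)
            have h3 : (S *ᵥ castVec x) ⬝ᵥ (S *ᵥ castVec x) = u x := by
              have := quadForm_conj S 1 (castVec x)
              rw [Matrix.mul_one] at this
              rw [hu]
              simp only
              rw [this, quadForm, Matrix.one_mulVec]
            rw [h3] at h2
            have h4 := hupos x hx
            have h5 := heatRate_nonneg s (Real.log (u x))
            calc _ ≤ heatRate s (Real.log (u x)) / u x ^ 2 * u x ^ 2 := by gcongr
              _ = _ := by field_simp
  have hcard : (H.card : ℝ) ≤ 4 * ∑ x ∈ F, if u x = 1 then heatRate s (Real.log (u x)) else 0 := by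
    rw [← Finset.sum_filter, ← hH, Finset.mul_sum]
    calc (H.card : ℝ) = ∑ _x ∈ H, (1 : ℝ) := by simp
      _ ≤ _ := by
          refine Finset.sum_le_sum fun x hx => ?_
          rw [(Finset.mem_filter.1 hx).2, Real.log_one]
          linarith [quarter_le_heatRate_zero s]
  have htot : ∑ x ∈ F, heatRate s (Real.log (u x)) =
      (∑ x ∈ F, if u x = 1 then 0 else heatRate s (Real.log (u x))) +
      ∑ x ∈ F, if u x = 1 then heatRate s (Real.log (u x)) else 0 := by
    rw [← Finset.sum_add_distrib]
    refine Finset.sum_congr rfl fun x _ => ?_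
    split_ifs <;> simp
  have hk' : (n : ℝ) * (n + 1) ≤ 2 * (k + H.card + 1) := by exact_mod_cast hk
  rw [htot]
  linarith

lemma abs_apply_le_trace {n : ℕ} {A : Matrix (Fin n) (Fin n) ℝ} (hA : A.PosSemidef)
    (i j : Fin n) : |A i j| ≤ A.trace := by
  have hdiag : ∀ k, A k k ≤ A.trace := fun k =>
    Finset.single_le_sum (f := fun k => A k k) (fun k _ => hA.diag_nonneg) (Finset.mem_univ k)
  have hsymm : A j i = A i j := by simpa using hA.1.apply i j
  have h1 := quadForm_nonneg hA (Pi.single i 1 + Pi.single j 1)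
  have h2 := quadForm_nonneg hA (Pi.single i 1 - Pi.single j 1)
  simp only [quadForm, Matrix.mulVec_add, Matrix.mulVec_sub, add_dotProduct, sub_dotProduct,
    Matrix.mulVec_single_one, single_one_dotProduct, Pi.add_apply, Pi.sub_apply,
    Matrix.col_apply, hsymm] at h1 h2
  rw [abs_le]
  constructor <;> linarith [hdiag i, hdiag j]

lemma isCompact_setOf_isAdmissible_trace_eq {n : ℕ} (c : ℝ) :
    IsCompact {A : Matrix (Fin n) (Fin n) ℝ | IsAdmissible A ∧ A.trace = c} := by
  have hbox : IsCompact {A : Matrix (Fin n) (Fin n) ℝ | ∀ i j, A i j ∈ Icc (-c) c} := by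
    have h : IsCompact (X := Matrix (Fin n) (Fin n) ℝ)
        (univ.pi fun _ : Fin n => univ.pi fun _ : Fin n => Icc (-c) c) :=
      isCompact_univ_pi fun _ => isCompact_univ_pi fun _ => isCompact_Icc
    refine h.of_isClosed_subset ?_ fun A hA i _ j _ => hA i j
    simp only [ofPred_forall]
    exact isClosed_iInter fun i => isClosed_iInter fun j => isClosed_Icc.preimage (by fun_prop)
  have hclosed : IsClosed {A : Matrix (Fin n) (Fin n) ℝ | IsAdmissible A ∧ A.trace = c} := by
    have h : {A : Matrix (Fin n) (Fin n) ℝ | IsAdmissible A ∧ A.trace = c} =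
        {A | Aᵀ = A} ∩ (⋂ v, {A | 0 ≤ quadForm A v}) ∩
          (⋂ x : Fin n → ℤ, ⋂ _ : x ≠ 0, {A | 1 ≤ quadForm A (castVec x)}) ∩ {A | A.trace = c} := by
      ext A
      simp only [IsAdmissible, mem_ofPred_eq, mem_inter_iff, mem_iInter]
      refine and_congr_left fun _ => and_congr_left fun _ => ⟨fun h => ⟨?_, quadForm_nonneg h⟩,
        fun h => posSemidef_of_quadForm h.1 h.2⟩
      simpa [Matrix.IsHermitian] using h.1
    rw [h]
    refine (((isClosed_eq (by fun_prop) continuous_id).inter (isClosed_iInter fun v => ?_)).inter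
      (isClosed_iInter fun x => isClosed_iInter fun _ => ?_)).inter
      (isClosed_eq (by fun_prop) continuous_const)
    · exact isClosed_le continuous_const (continuous_quadForm v)
    · exact isClosed_le continuous_const (continuous_quadForm _)
  refine hbox.of_isClosed_subset hclosed ?_
  rintro A ⟨hA, rfl⟩ i j
  exact abs_le.1 (abs_apply_le_trace hA.1 i j)

lemma continuousOn_latticeFunctional {n : ℕ} {F : Finset (Fin n → ℤ)} (hF0 : 0 ∉ F) :
    ContinuousOn (fun p : ℝ × Matrix (Fin n) (Fin n) ℝ => latticeFunctional F p.1 p.2)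
      (Ioi 0 ×ˢ {A | IsAdmissible A}) := by
  unfold latticeFunctional
  refine ContinuousOn.sub (ContinuousOn.neg (ContinuousOn.log ?_ ?_))
    (continuousOn_const.mul (continuousOn_finsetSum _ fun x hx => ?_))
  · exact (Continuous.matrix_det continuous_snd).continuousOn
  · exact fun p hp => hp.2.posDef.det_pos.ne'
  · refine continuousOn_heatPot_log.comp (f := fun p : ℝ × Matrix (Fin n) (Fin n) ℝ =>
      (p.1, quadForm p.2 (castVec x))) ?_ fun p hp => ⟨hp.1, ?_⟩
    · exact (continuous_fst.prodMk ((continuous_quadForm _).comp continuous_snd)).continuousOn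
    · exact lt_of_lt_of_le one_pos (hp.2.2 x (by rintro rfl; exact hF0 hx))

lemma hasDerivAt_latticeFunctional {n : ℕ} (F : Finset (Fin n → ℤ)) {T t : ℝ} (ht : t < T)
    (A : Matrix (Fin n) (Fin n) ℝ) :
    HasDerivAt (fun t => latticeFunctional F (T - t) A)
      (2 * ∑ x ∈ F, heatRate (T - t) (Real.log (quadForm A (castVec x)))) t := by
  unfold latticeFunctional
  have h : ∀ x ∈ F, HasDerivAt (fun t => heatPot (T - t) (Real.log (quadForm A (castVec x))))
      (-heatRate (T - t) (Real.log (quadForm A (castVec x)))) t := fun x _ => by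
    have := (hasDerivAt_heatPot_left (sub_pos.2 ht)
      (Real.log (quadForm A (castVec x)))).comp t ((hasDerivAt_id t).const_sub T)
    rw [mul_neg, mul_one] at this
    exact this
  have := ((HasDerivAt.fun_sum h).const_mul 2).const_sub (-Real.log A.det)
  refine this.congr_deriv ?_
  rw [Finset.sum_neg_distrib]
  ring

/-- Starting from a lattice with small total potential one can reach a lattice of much smaller
covolume. -/
lemma exists_isAdmissible_log_det_le {n : ℕ} {A₀ : Matrix (Fin n) (Fin n) ℝ}
    (hA₀ : IsAdmissible A₀) {T T' : ℝ} (hT : 0 < T) (hTT' : T < T') {C : ℝ}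
    (hC : ∀ F : Finset (Fin n → ℤ), 0 ∉ F →
      ∑ x ∈ F, heatPot T' (Real.log (quadForm A₀ (castVec x))) ≤ C) :
    ∃ A : Matrix (Fin n) (Fin n) ℝ, IsAdmissible A ∧
      Real.log A.det ≤ Real.log A₀.det + 2 * C - ((n : ℝ) ^ 2 / 4 - 1) * T := by
  classical
  set K := {A : Matrix (Fin n) (Fin n) ℝ | IsAdmissible A ∧ A.trace = A₀.trace}
  have hK : IsCompact K := isCompact_setOf_isAdmissible_trace_eq _
  obtain ⟨l, hl, hlK⟩ := exists_pos_mul_sq_norm_le_quadForm hK fun A hA => hA.1.posDef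
  set F := (finite_setOf_mul_sq_norm_le (n := n) hl 1).toFinset.erase 0 with hFdef
  have hF0 : 0 ∉ F := Finset.notMem_erase _ _
  have hF : ∀ A ∈ K, ∀ x : Fin n → ℤ, x ≠ 0 → quadForm A (castVec x) = 1 → x ∈ F := by
    intro A hA x hx0 hx
    refine Finset.mem_erase.2 ⟨hx0, ?_⟩
    rw [Set.Finite.mem_toFinset, mem_ofPred_eq, ← hx]
    exact hlK A hA _
  set ρ : ℝ := (n : ℝ) ^ 2 / 4 - 1 with hρ
  have hcont : ContinuousOn (fun p : ℝ × Matrix (Fin n) (Fin n) ℝ =>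
      latticeFunctional F (T' - p.1) p.2 - ρ * p.1) (Icc 0 T ×ˢ K) := by
    refine ContinuousOn.sub ((continuousOn_latticeFunctional hF0).comp
      (f := fun p : ℝ × Matrix (Fin n) (Fin n) ℝ => (T' - p.1, p.2)) (by fun_prop) ?_)
      (by fun_prop)
    exact fun p hp => ⟨sub_pos.2 (hp.1.2.trans_lt hTT'), hp.2.1⟩
  have h0mem : ((0 : ℝ), A₀) ∈ Icc 0 T ×ˢ K := ⟨⟨le_rfl, hT.le⟩, hA₀, rfl⟩
  obtain ⟨⟨t, A⟩, ⟨ht, hA⟩, hmax⟩ := (isCompact_Icc.prod hK).exists_isMaxOn ⟨_, h0mem⟩ hcont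
  have hmax' : ∀ s ∈ Icc 0 T, ∀ B ∈ K, latticeFunctional F (T' - s) B - ρ * s ≤
      latticeFunctional F (T' - t) A - ρ * t := fun s hs B hB => hmax (a := (s, B)) ⟨hs, hB⟩
  simp only at ht hA
  refine ⟨A, hA.1, ?_⟩
  have htT : t = T := by
    by_contra hne
    have hlt : t < T := lt_of_le_of_ne ht.2 hne
    have h1 := nonpos_of_hasDerivAt_of_le hlt
      ((hasDerivAt_latticeFunctional F (hlt.trans hTT') A).sub ((hasDerivAt_id t).const_mul ρ))
      fun s hs => hmax' s ⟨ht.1.trans hs.1, hs.2⟩ A hA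
    have h2 := le_sum_heatRate_of_maximal hF0 (sub_pos.2 (hlt.trans hTT')) hA.1 (hF A hA)
      fun B hB hBtr => by
        have := hmax' t ht B ⟨hB, hBtr.trans hA.2⟩
        linarith
    have h3 : (0 : ℝ) ≤ n := n.cast_nonneg
    rw [hρ] at h1
    linarith
  subst htT
  have h1 := hmax' 0 h0mem.1 A₀ h0mem.2
  simp only [latticeFunctional, sub_zero, mul_zero] at h1
  have h2 : 0 ≤ ∑ x ∈ F, heatPot (T' - t) (Real.log (quadForm A (castVec x))) :=
    Finset.sum_nonneg fun x _ => heatPot_nonneg (sub_pos.2 hTT').le _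
  linarith [hC F hF0]

/-- The radial weight penalising short vectors: the indicator of the unit ball plus a multiple of
the potential. -/
def radialWeight (s κ r : ℝ) : ENNReal :=
  (Iio 1).indicator 1 r + ENNReal.ofReal (κ * heatPot s (2 * Real.log (max 1 r)))

lemma radialWeight_antitone {s κ : ℝ} (hs : 0 ≤ s) (hκ : 0 ≤ κ) : Antitone (radialWeight s κ) := by
  intro a b hab
  unfold radialWeight
  gcongr ?_ + ENNReal.ofReal (κ * ?_)
  · by_cases hb : b < 1
    · rw [indicator_of_mem (mem_Iio.2 hb), indicator_of_mem (mem_Iio.2 (hab.trans_lt hb))]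
      rfl
    · rw [indicator_of_notMem (by simpa using hb)]
      exact zero_le
  · refine heatPot_antitone hs ?_
    gcongr

lemma radialWeight_of_lt_one (s κ : ℝ) {r : ℝ} (hr : r < 1) :
    radialWeight s κ r = radialWeight s κ 0 := by
  simp [radialWeight, indicator_of_mem (mem_Iio.2 hr), hr.le]

lemma radialWeight_le {s κ m : ℝ} (hs : 0 < s) (hκ : 0 ≤ κ) (n : ℕ)
    (hm : m = (n + 1) / 2) {r : ℝ} (hr : 1 ≤ r) :
    radialWeight s κ r ≤ ENNReal.ofReal (κ * (Real.exp (m * s / 2 + m ^ 2 * s / 2) / m ^ 2)) *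
      ENNReal.ofReal ((r ^ (n + 1))⁻¹) := by
  have hm0 : 0 < m := by rw [hm]; positivity
  have hr0 : 0 < r := one_pos.trans_le hr
  rw [radialWeight, indicator_of_notMem (by simpa using hr), zero_add, max_eq_right hr,
    ← ENNReal.ofReal_mul (by positivity), mul_assoc]
  gcongr
  refine (heatPot_le_exp hs hm0 _).trans (le_of_eq ?_)
  congr 1
  rw [show -m * (2 * Real.log r) = -(((n + 1 : ℕ) : ℝ) * Real.log r) by rw [hm]; push_cast; ring,
    Real.exp_neg, Real.exp_nat_mul, Real.exp_log hr0]

lemma lintegral_radialWeight_le {n : ℕ} (hn : 0 < n) {s κ : ℝ} (hs : 0 < s) (hκ : 0 ≤ κ) :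
    ∫⁻ y : Euc n, radialWeight s κ ‖y‖ ≤
      (1 + ENNReal.ofReal (κ * (2 / n ^ 2 * expSum * Real.exp (n ^ 2 * s / 8 + n * s / 4)))) *
        volume (Metric.ball (0 : Euc n) 1) := by
  have h1 : ∀ y : Euc n, radialWeight s κ ‖y‖ = (Metric.ball (0 : Euc n) 1).indicator 1 y +
      ENNReal.ofReal κ * ENNReal.ofReal (heatPot s (2 * Real.log (max 1 ‖y‖))) := by
    intro y
    classical
    rw [radialWeight, ENNReal.ofReal_mul hκ]
    congr 1
    simp only [indicator_apply, mem_Iio, mem_ball_zero_iff, Pi.one_apply]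
  simp_rw [h1]
  rw [lintegral_add_left (measurable_one.indicator measurableSet_ball),
    lintegral_indicator_one measurableSet_ball, lintegral_const_mul' _ _ ENNReal.ofReal_ne_top,
    add_mul, one_mul, ENNReal.ofReal_mul hκ, mul_assoc]
  gcongr
  exact lintegral_heatPot_le hn hs

/-- A lattice of bounded normalised covolume with minimal norm at least one and bounded total
potential. -/
lemma exists_isAdmissible_sum_heatPot_le {n : ℕ} (hn : 2 ≤ n) {s M : ℝ} (hs : 0 < s) (hM : 0 < M)
    (hsM : 2 / n ^ 2 * expSum * Real.exp (n ^ 2 * s / 8 + n * s / 4) ≤ M) :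
    ∃ A : Matrix (Fin n) (Fin n) ℝ, IsAdmissible A ∧
      A.det = (3 * (volume (Metric.ball (0 : Euc n) 1)).toReal) ^ 2 ∧
      ∀ F : Finset (Fin n → ℤ), 0 ∉ F →
        ∑ x ∈ F, heatPot s (Real.log (quadForm A (castVec x))) ≤ M := by
  have : Nonempty (Fin n) := ⟨⟨0, by omega⟩⟩
  set ω := volume (Metric.ball (0 : Euc n) 1) with hω
  have hω0 : ω ≠ 0 := (Metric.measure_ball_pos _ _ one_pos).ne'
  have hωt : ω ≠ ⊤ := measure_ball_lt_top.ne
  have hωr : 0 < ω.toReal := ENNReal.toReal_pos hω0 hωt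
  have hκ : 0 ≤ M⁻¹ := (inv_pos.2 hM).le
  have hI : ∫⁻ y : Euc n, radialWeight s M⁻¹ ‖y‖ < ENNReal.ofReal (3 * ω.toReal) := by
    refine (lintegral_radialWeight_le (by omega) hs hκ).trans_lt ?_
    rw [← hω, ENNReal.ofReal_mul zero_le_three, ENNReal.ofReal_toReal hωt]
    refine ENNReal.mul_lt_mul_left hω0 hωt (lt_of_le_of_lt (b := 1 + 1) ?_ (by norm_num))
    gcongr
    rw [← ENNReal.ofReal_one]
    refine ENNReal.ofReal_le_ofReal ?_
    rwa [inv_mul_le_iff₀ hM, mul_one]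
  obtain ⟨S, hSdet, hS⟩ := exists_lattice_sum_lt_one hn (radialWeight_antitone hs.le hκ)
    (fun r _ hr => radialWeight_of_lt_one s M⁻¹ hr) ENNReal.ofReal_ne_top
    (fun r hr => radialWeight_le hs hκ n rfl hr) (mul_pos three_pos hωr) hI
  have hterm : ∀ x : Fin n → ℤ, x ≠ 0 → 1 ≤ ‖(WithLp.toLp 2 (S *ᵥ castVec x) : Euc n)‖ := by
    intro x hx
    by_contra! hlt
    have h1 := (ENNReal.le_tsum (⟨x, hx⟩ : {x : Fin n → ℤ // x ≠ 0})).trans_lt hS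
    refine h1.not_ge ?_
    rw [radialWeight, indicator_of_mem (mem_Iio.2 hlt)]
    exact le_self_add
  refine ⟨Sᵀ * S, ⟨posSemidef_of_quadForm ?_ fun v => ?_, fun x hx => ?_⟩, ?_, fun F hF => ?_⟩
  · rw [Matrix.transpose_mul, Matrix.transpose_transpose]
  · rw [quadForm_transpose_mul_self]
    positivity
  · rw [quadForm_transpose_mul_self]
    exact one_le_pow₀ (hterm x hx)
  · rw [Matrix.det_mul, Matrix.det_transpose, hSdet, sq]
  · have hx0 : ∀ x ∈ F, x ≠ 0 := by
      rintro x hx rfl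
      exact hF hx
    have h1 := (ENNReal.sum_le_tsum (F.subtype (· ≠ 0))).trans hS.le
    rw [Finset.sum_subtype_of_mem (p := (· ≠ 0))
      (fun x => radialWeight s M⁻¹ ‖(WithLp.toLp 2 (S *ᵥ castVec x) : Euc n)‖) hx0] at h1
    have h2 : ENNReal.ofReal
        (∑ x ∈ F, M⁻¹ * heatPot s (Real.log (quadForm (Sᵀ * S) (castVec x)))) ≤ 1 := by
      rw [ENNReal.ofReal_sum_of_nonneg fun x _ => mul_nonneg hκ (heatPot_nonneg hs.le _)]
      refine (Finset.sum_le_sum fun x hx => ?_).trans h1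
      rw [quadForm_transpose_mul_self, Real.log_pow, radialWeight,
        max_eq_right (hterm x (hx0 x hx))]
      exact le_add_self
    rwa [ENNReal.ofReal_le_one, ← Finset.mul_sum, inv_mul_le_iff₀ hM, mul_one] at h2

lemma halfBallVolume_eq (n : ℕ) :
    halfBallVolume n = (volume (Metric.ball (0 : Euc n) 1)).toReal / 2 ^ n := by
  rw [halfBallVolume, Measure.addHaar_ball_of_pos _ _ (by norm_num), ENNReal.toReal_mul,
    finrank_euclideanSpace_fin, ENNReal.toReal_ofReal (by positivity), div_pow, one_pow]
  ring

lemma exists_isAdmissible_sqrt_det_le {n : ℕ} (hn : 2 ≤ n) {M : ℝ}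
    (hM : 2 * expSum * Real.exp 5 ≤ M) (hM0 : 0 < M) :
    ∃ A : Matrix (Fin n) (Fin n) ℝ, IsAdmissible A ∧
      √A.det ≤ 3 * (volume (Metric.ball (0 : Euc n) 1)).toReal * Real.exp (M + 8) / n ^ 2 := by
  have : Nonempty (Fin n) := ⟨⟨0, by omega⟩⟩
  set ω := (volume (Metric.ball (0 : Euc n) 1)).toReal
  have hω : 0 < ω :=
    ENNReal.toReal_pos (Metric.measure_ball_pos _ _ one_pos).ne' measure_ball_lt_top.ne
  have hn' : (2 : ℝ) ≤ n := by exact_mod_cast hn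
  have hn0 : (0 : ℝ) < n := by linarith
  set L := Real.log n with hL
  have hL0 : 0 < L := Real.log_pos (by linarith)
  have hLn : L ≤ n := (Real.log_le_sub_one_of_pos hn0).trans (by linarith)
  have hexp : Real.exp L = n := Real.exp_log hn0
  set T := 16 * L / (n : ℝ) ^ 2 with hT
  have hT0 : 0 < T := by positivity
  have hT16 : T ≤ 16 := by
    rw [hT, div_le_iff₀ (by positivity)]
    nlinarith
  have hTn : (n : ℝ) ^ 2 * T = 16 * L := by
    rw [hT]
    field_simp
  set T' := T + 1 / (n : ℝ) ^ 2 with hT'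
  have hTT' : T < T' := lt_add_of_pos_right _ (by positivity)
  have hT'n : (n : ℝ) ^ 2 * T' = 16 * L + 1 := by
    rw [hT', mul_add, hTn]
    field_simp
  have hT'1 : n * T' ≤ 16 + 1 / 2 := by
    have h1 : n * T' = (16 * L + 1) / n := by
      rw [← hT'n]
      field_simp
    rw [h1, div_le_iff₀ hn0]
    linarith
  have hsM : 2 / n ^ 2 * expSum * Real.exp (n ^ 2 * T' / 8 + n * T' / 4) ≤ M := by
    refine le_trans ?_ hM
    have h1 : (n : ℝ) ^ 2 * T' / 8 + n * T' / 4 ≤ L + L + 5 := by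
      rw [hT'n]
      linarith
    have h2 := expSum_nonneg
    calc _ ≤ 2 / (n : ℝ) ^ 2 * expSum * Real.exp (L + L + 5) := by gcongr
      _ = _ := by
        rw [Real.exp_add, Real.exp_add, hexp]
        field_simp
  obtain ⟨A₀, hA₀, hdet₀, hsum⟩ :=
    exists_isAdmissible_sum_heatPot_le hn (hT0.trans hTT') hM0 hsM
  obtain ⟨A, hA, hdet⟩ := exists_isAdmissible_log_det_le hA₀ hT0 hTT' hsum
  refine ⟨A, hA, Real.sqrt_le_iff.2 ⟨by positivity, ?_⟩⟩
  rw [hdet₀, Real.log_pow] at hdet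
  have hpos := hA.posDef.det_pos
  have hX : 0 < 3 * ω * Real.exp (M + 8) / (n : ℝ) ^ 2 := by positivity
  rw [← Real.log_le_log_iff hpos (by positivity), Real.log_pow,
    Real.log_div (by positivity) (by positivity), Real.log_mul (by positivity) (by positivity),
    Real.log_exp, Real.log_pow]
  push_cast at hdet ⊢
  nlinarith

end LatticePacking

theorem delta_n_ge_c_n_sq_two_pow_neg_n :
    ∃ c : ℝ, 0 < c ∧ ∀ n : ℕ, 2 ≤ n →
      c * (n : ℝ) ^ 2 / 2 ^ n ≤ sSup (packingDensities n) := by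
  set M := 2 * expSum * Real.exp 5 + 1 with hM
  have hM0 : 0 < M := by
    have := expSum_nonneg
    positivity
  refine ⟨1 / (3 * Real.exp (M + 8)), by positivity, fun n hn => ?_⟩
  obtain ⟨A, hA, hdet⟩ := exists_isAdmissible_sqrt_det_le hn (M := M) (by linarith) hM0
  have hpos := hA.posDef.det_pos
  refine le_trans ?_ (le_csSup (bddAbove_packingDensities n)
    (halfBallVolume_div_sqrt_det_mem hA hpos.ne'))
  have : Nonempty (Fin n) := ⟨⟨0, by omega⟩⟩
  have hω : 0 < (volume (Metric.ball (0 : Euc n) 1)).toReal :=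
    ENNReal.toReal_pos (Metric.measure_ball_pos _ _ one_pos).ne' measure_ball_lt_top.ne
  have hn0 : (0 : ℝ) < n := by
    have : 0 < n := by omega
    exact_mod_cast this
  rw [halfBallVolume_eq]
  rw [le_div_iff₀ (Real.sqrt_pos.2 hpos)]
  refine (mul_le_mul_of_nonneg_left hdet (by positivity)).trans (le_of_eq ?_)
  field_simp
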